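/- Let 0 < s < 1/2 and let f be a real-valued smooth compactly supported function on ℝ^{2n+1}. Define φ_s(v,t) = (|v|⁴ + 16t²)^{−(n+1+s)/4}, ψ_s(p) = C₁(n,s) ∫_{ℝ^{2n+1}} φ_s(p·q^{−1}) |q|^{−(Q−2s)} dq, and w_s = φ_s/ψ_s. Then (A_{n,s}/2) ∫_{ℝ^{2n+1}} ∫_{ℝ^{2n+1}} (f(p) − f(q))² |q^{−1}·p|^{−(Q+2s)} dq dp ≥ 4^{2s} (Γ((n+1+s)/2)/Γ((n+1−s)/2))² ∫_{ℝ^{2n+1}} f(p)² w_s(p) dp, where A_{n,s} = (4^{1+s} s / π^{n+1/2}) · Γ(n+s) Γ((n+1+s)/2) / (Γ((n+s)/2) Γ(1−s)). -/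

import Mathlib

noncomputable section
open MeasureTheory Real Set Topology Filter
open scoped ENNReal NNReal

/-- The Heisenberg group `ℍⁿ = ℝⁿ × ℝⁿ × ℝ ≅ ℝ^{2n+1}`, points `p = (x, y, t)`. -/
abbrev Heis (n : ℕ) := EuclideanSpace ℝ (Fin n) × EuclideanSpace ℝ (Fin n) × ℝ

namespace Heis

variable {n : ℕ}

/-- The Heisenberg group law
`(x,y,t)·(x',y',t') = (x+x', y+y', t+t' + (1/2)∑ (y_j x'_j − x_j y'_j))`. -/
def hmul (p q : Heis n) : Heis n :=
  (p.1 + q.1, p.2.1 + q.2.1,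
    p.2.2 + q.2.2 + 1 / 2 * ∑ j, (p.2.1 j * q.1 j - p.1 j * q.2.1 j))

/-- The Heisenberg group inverse `p⁻¹ = (-x, -y, -t)`. -/
def hinv (p : Heis n) : Heis n := (-p.1, -p.2.1, -p.2.2)

/-- Convolution on `ℍⁿ`: `(f ∗ g)(p) = ∫ f(p·q⁻¹) g(q) dq`. -/
def hconv (f g : Heis n → ℝ) (p : Heis n) : ℝ :=
  ∫ q : Heis n, f (hmul p (hinv q)) * g q

/-- The homogeneous norm `|(v,t)| = (|v|⁴ + 16 t²)^{1/4}`. -/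
def hnorm (p : Heis n) : ℝ :=
  ((‖p.1‖ ^ 2 + ‖p.2.1‖ ^ 2) ^ 2 + 16 * p.2.2 ^ 2) ^ ((1 : ℝ) / 4)

/-- The kernel `φ_{s,ρ}(v,t) = ((ρ²+|v|²)² + 16t²)^{-(n+1+s)/2}`. -/
def phiK (n : ℕ) (s ρ : ℝ) (p : Heis n) : ℝ :=
  ((ρ ^ 2 + (‖p.1‖ ^ 2 + ‖p.2.1‖ ^ 2)) ^ 2 + 16 * p.2.2 ^ 2) ^
    (-(((n : ℝ) + 1 + s) / 2))

/-- `C₁(n,s) = (4/π^{n+1/2})·Γ(n+s)Γ((n+1+s)/2)/(Γ(s)Γ((n+s)/2))`. -/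
def C1 (n : ℕ) (s : ℝ) : ℝ :=
  4 / π ^ ((n : ℝ) + 1 / 2) *
    (Gamma ((n : ℝ) + s) * Gamma (((n : ℝ) + 1 + s) / 2)) /
    (Gamma s * Gamma (((n : ℝ) + s) / 2))

/-- The left-invariant vector field `X_j = ∂_{x_j} + (1/2) y_j ∂_t`. -/
def vfX (j : Fin n) (F : Heis n → ℝ) (p : Heis n) : ℝ :=
  fderiv ℝ F p (EuclideanSpace.single j 1, 0, 0) +
    1 / 2 * p.2.1 j * fderiv ℝ F p (0, 0, 1)

/-- The left-invariant vector field `X_{n+j} = ∂_{y_j} − (1/2) x_j ∂_t`. -/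
def vfY (j : Fin n) (F : Heis n → ℝ) (p : Heis n) : ℝ :=
  fderiv ℝ F p (0, EuclideanSpace.single j 1, 0) -
    1 / 2 * p.1 j * fderiv ℝ F p (0, 0, 1)

/-- The vector field `∂_t`. -/
def vfT (F : Heis n → ℝ) (p : Heis n) : ℝ := fderiv ℝ F p (0, 0, 1)

/-- The sublaplacian `𝓛 = −∑_{j=1}^{2n} X_j²`. -/
def subL (F : Heis n → ℝ) (p : Heis n) : ℝ :=
  -(∑ j, (vfX j (vfX j F) p + vfY j (vfY j F) p))

/-- The extension operator
`𝕃u = −𝓛u + ∂_ρ²u + ((1−2s)/ρ)∂_ρu + (1/4)ρ²∂_t²u`, for `u = u(p, ρ)`. -/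
def extOp (s : ℝ) (u : Heis n → ℝ → ℝ) (p : Heis n) (ρ : ℝ) : ℝ :=
  -subL (fun q => u q ρ) p + deriv (deriv (u p)) ρ +
    (1 - 2 * s) / ρ * deriv (u p) ρ +
    1 / 4 * ρ ^ 2 * vfT (fun q => vfT (fun q' => u q' ρ) q) p

/-- `|∇u|² = ∑_{j=1}^{2n} (X_j u)² + (1/4)(∂_t u)² + (∂_ρ u)²` for `u = u(p, ρ)`. -/
def gradSq (u : Heis n → ℝ → ℝ) (p : Heis n) (ρ : ℝ) : ℝ :=
  (∑ j, ((vfX j (fun q => u q ρ) p) ^ 2 + (vfY j (fun q => u q ρ) p) ^ 2)) +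
    1 / 4 * (vfT (fun q => u q ρ) p) ^ 2 + (deriv (u p) ρ) ^ 2

end Heis

open Heis

namespace Heis

/-- `φ_s(v,t) = (|v|⁴ + 16t²)^{-(n+1+s)/4}`. -/
def phiS (n : ℕ) (s : ℝ) (p : Heis n) : ℝ :=
  ((‖p.1‖ ^ 2 + ‖p.2.1‖ ^ 2) ^ 2 + 16 * p.2.2 ^ 2) ^ (-(((n : ℝ) + 1 + s) / 4))

/-- `ψ_s(p) = C₁(n,s) ∫ φ_s(p·q⁻¹) |q|^{-(Q-2s)} dq`, with `Q = 2n+2`. -/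
def psiS (n : ℕ) (s : ℝ) (p : Heis n) : ℝ :=
  C1 n s * ∫ q : Heis n,
    phiS n s (hmul p (hinv q)) * hnorm q ^ (-(2 * (n : ℝ) + 2 - 2 * s))

end Heis

namespace Heis


/-! ### One-dimensional Fourier analysis of `(A² + 16t²)^{-b}` -/

/-- The profile `t ↦ (A² + 16t²)^{-b}`. -/
def profile (b A t : ℝ) : ℝ := (A ^ 2 + 16 * t ^ 2) ^ (-b)

/-- The (unnormalised) Gamma density `x^{b-1} e^{-Ax}` on the positive half-line. -/
def gammaDens (b A : ℝ) : ℝ → ℝ :=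
  (Ioi 0).indicator fun x => x ^ (b - 1) * exp (-(A * x))

/-- The integrand of `besselG`. -/
def besselKer (b A u y : ℝ) : ℝ := (y * (y + |u|)) ^ (b - 1) * exp (-(A * (2 * y + |u|)))

/-- The autocorrelation of `gammaDens`, whose Fourier transform is a multiple of `profile`. -/
def besselG (b A u : ℝ) : ℝ := ∫ y in Ioi 0, besselKer b A u y

lemma gammaDens_nonneg (b A x : ℝ) : 0 ≤ gammaDens b A x := by
  apply indicator_nonneg
  intro x hx
  have : (0 : ℝ) < x := hx
  positivity

lemma integrable_gammaDens {b A : ℝ} (hb : 0 < b) (hA : 0 < A) : Integrable (gammaDens b A) := by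
  rw [gammaDens, integrable_indicator_iff measurableSet_Ioi]
  have := integrableOn_rpow_mul_exp_neg_mul_rpow (p := 1) (s := b - 1) (b := A)
    (by linarith) one_pos hA
  simpa using this

lemma measurable_gammaDens (b A : ℝ) : Measurable (gammaDens b A) := by
  unfold gammaDens
  refine Measurable.indicator ?_ measurableSet_Ioi
  fun_prop

lemma exp_mul_gammaDens (b A r x : ℝ) :
    exp (r * x) * gammaDens b A x = gammaDens b (A - r) x := by
  unfold gammaDens
  by_cases hx : x ∈ Ioi (0 : ℝ)
  · rw [indicator_of_mem hx, indicator_of_mem hx, mul_left_comm, ← exp_add]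
    congr 2; ring
  · rw [indicator_of_notMem hx, indicator_of_notMem hx, mul_zero]

lemma integral_gammaDens {b A : ℝ} (hb : 0 < b) (hA : 0 < A) :
    ∫ x, gammaDens b A x = (1 / A) ^ b * Gamma b := by
  rw [← integral_rpow_mul_exp_neg_mul_Ioi hb hA, ← integral_indicator measurableSet_Ioi]
  rfl

lemma integral_cexp_mul_gammaDens {b A : ℝ} (hb : 0 < b) {z : ℂ} (hz : z.re < A) :
    ∫ x : ℝ, Complex.exp (z * x) * gammaDens b A x =
      (1 / (A - z)) ^ (b : ℂ) * Complex.Gamma b := by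
  set d : ℝ → ℝ≥0 := fun x => (gammaDens b A x).toNNReal with hd
  have hdm : Measurable d := (measurable_gammaDens b A).real_toNNReal
  have hdx : ∀ x, (d x : ℝ) = gammaDens b A x := fun x =>
    Real.coe_toNNReal _ (gammaDens_nonneg b A x)
  set μ : Measure ℝ := volume.withDensity fun x => (d x : ℝ≥0∞) with hμ
  have hmgf : ∀ w : ℂ, ProbabilityTheory.complexMGF id μ w =
      ∫ x : ℝ, Complex.exp (w * x) * gammaDens b A x := by
    intro w
    rw [ProbabilityTheory.complexMGF, hμ, integral_withDensity_eq_integral_smul hdm]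
    congr 1
    ext x
    rw [NNReal.smul_def, hdx, Complex.real_smul, mul_comm]
    rfl
  have hset : Iio A ⊆ ProbabilityTheory.integrableExpSet id μ := by
    intro r hr
    have hr' : r < A := hr
    change Integrable _ _
    rw [hμ, integrable_withDensity_iff_integrable_smul hdm]
    refine (integrable_gammaDens hb (sub_pos.2 hr')).congr (ae_of_all _ fun x => ?_)
    simp only [NNReal.smul_def, hdx, smul_eq_mul, id]
    rw [mul_comm, exp_mul_gammaDens]
  have hset' : Iio A ⊆ interior (ProbabilityTheory.integrableExpSet id μ) :=
    interior_maximal hset isOpen_Iio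
  set S : Set ℂ := {w | w.re < A} with hS
  have hSo : IsOpen S := isOpen_Iio.preimage Complex.continuous_re
  have hf : AnalyticOnNhd ℂ (ProbabilityTheory.complexMGF id μ) S :=
    ProbabilityTheory.analyticOnNhd_complexMGF.mono fun w hw => hset' hw
  have hg : AnalyticOnNhd ℂ (fun w : ℂ => (1 / (A - w)) ^ (b : ℂ) * Complex.Gamma b) S := by
    refine DifferentiableOn.analyticOnNhd (fun w hw => ?_) hSo
    have hw' : w.re < A := hw
    have hre : 0 < ((A : ℂ) - w).re := by simpa using hw'
    have hne : (A : ℂ) - w ≠ 0 := fun h => by simp [h] at hre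
    refine DifferentiableAt.differentiableWithinAt ?_
    refine DifferentiableAt.mul_const (DifferentiableAt.cpow ?_ (by fun_prop) (Or.inl ?_)) _
    · exact (differentiableAt_const _).div (by fun_prop) hne
    · rw [one_div, Complex.inv_re]
      exact div_pos hre (Complex.normSq_pos.2 hne)
  have hconn : IsPreconnected S := (convex_halfSpace_re_lt A).isPreconnected
  have hA0 : ((A - 1 : ℝ) : ℂ) ∈ S := by simp [hS]
  have hreal : ∀ r : ℝ, r < A → ProbabilityTheory.complexMGF id μ r =
      (1 / (A - (r : ℂ))) ^ (b : ℂ) * Complex.Gamma b := by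
    intro r hr
    rw [hmgf, Complex.Gamma_ofReal]
    have h1 : ∀ x : ℝ, Complex.exp (r * x) * gammaDens b A x =
        ((gammaDens b (A - r) x : ℝ) : ℂ) := by
      intro x
      rw [← exp_mul_gammaDens b A r x]
      push_cast
      rfl
    simp_rw [h1]
    rw [integral_complex_ofReal, integral_gammaDens hb (sub_pos.2 hr)]
    push_cast
    rw [Complex.ofReal_cpow (by have := sub_pos.2 hr; positivity)]
    push_cast
    rfl
  have key := hf.eqOn_of_preconnected_of_frequently_eq hg hconn hA0 ?_
  · rw [← hmgf]
    exact key hz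
  · have hlim : Tendsto (fun x : ℝ => (x : ℂ)) (𝓝[≠] (A - 1)) (𝓝[≠] ((A - 1 : ℝ) : ℂ)) := by
      refine tendsto_nhdsWithin_of_tendsto_nhds_of_eventually_within _ ?_ ?_
      · exact (Complex.continuous_ofReal.tendsto _).mono_left nhdsWithin_le_nhds
      · filter_upwards [self_mem_nhdsWithin] with x hx
        exact fun h => hx (Complex.ofReal_injective h)
    refine hlim.frequently (Eventually.frequently ?_)
    have : ∀ᶠ x in 𝓝[≠] (A - 1), x < A :=
      nhdsWithin_le_nhds (Iio_mem_nhds (by linarith))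
    filter_upwards [this] with x hx using hreal x hx

lemma integral_exp_mul_gammaDens {b A : ℝ} (hb : 0 < b) (hA : 0 < A) (t : ℝ) :
    ∫ x : ℝ, Complex.exp (-(4 * t * x) * Complex.I) * gammaDens b A x =
      (1 / (A + 4 * t * Complex.I)) ^ (b : ℂ) * Complex.Gamma b := by
  have h := integral_cexp_mul_gammaDens hb (A := A) (z := -(4 * t) * Complex.I) (by simpa using hA)
  rw [sub_eq_add_neg, neg_mul, neg_neg] at h
  rw [← h]
  congr 1
  ext x
  congr 2
  ring

lemma integral_gammaDens_corr (b A u : ℝ) :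
    ∫ y, gammaDens b A (y + u) * gammaDens b A y = besselG b A u := by
  have key : ∀ {v : ℝ}, 0 ≤ v →
      ∫ y, gammaDens b A (y + v) * gammaDens b A y = besselG b A v := by
    intro v hv
    rw [besselG, ← integral_indicator measurableSet_Ioi]
    congr 1
    ext y
    by_cases hy : y ∈ Ioi (0 : ℝ)
    · have hy' : (0 : ℝ) < y := hy
      have hyv : y + v ∈ Ioi (0 : ℝ) := by simp only [mem_Ioi]; linarith
      rw [gammaDens, indicator_of_mem hy, indicator_of_mem hy, indicator_of_mem hyv, besselKer,
        abs_of_nonneg hv, mul_rpow hy'.le (by linarith)]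
      have : exp (-(A * (2 * y + v))) = exp (-(A * (y + v))) * exp (-(A * y)) := by
        rw [← exp_add]; congr 1; ring
      rw [this]; ring
    · rw [gammaDens, indicator_of_notMem hy, indicator_of_notMem hy, mul_zero]
  rcases le_total 0 u with hu | hu
  · exact key hu
  · have h1 := key (v := -u) (by linarith)
    have h2 : besselG b A (-u) = besselG b A u := by
      simp [besselG, besselKer]
    rw [← h2, ← h1, ← integral_add_right_eq_self _ (-u)]
    congr 1
    ext y
    rw [mul_comm]
    simp

lemma integrable_shear_gammaDens {b A : ℝ} (hb : 0 < b) (hA : 0 < A) :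
    Integrable (fun z : ℝ × ℝ => gammaDens b A (z.1 + z.2) * gammaDens b A z.1)
      (volume.prod volume) := by
  have h1 := (integrable_gammaDens hb hA).mul_prod (integrable_gammaDens hb hA)
  have h2 := (measurePreserving_prod_add (volume : Measure ℝ) (volume : Measure ℝ)).integrable_comp
    (g := fun z : ℝ × ℝ => gammaDens b A z.1 * gammaDens b A z.2) h1.aestronglyMeasurable
  have h3 := h2.2 h1
  refine h3.congr (ae_of_all _ fun z => ?_)
  simp [mul_comm]

lemma integrable_besselG {b A : ℝ} (hb : 0 < b) (hA : 0 < A) : Integrable (besselG b A) := by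
  have := (integrable_shear_gammaDens hb hA).integral_prod_right
  exact this.congr (ae_of_all _ fun u => integral_gammaDens_corr b A u)

lemma besselG_nonneg (b A u : ℝ) : 0 ≤ besselG b A u := by
  refine setIntegral_nonneg measurableSet_Ioi fun y hy => ?_
  have : (0 : ℝ) < y := hy
  unfold besselKer
  positivity

lemma integral_exp_mul_besselG {b A : ℝ} (hb : 0 < b) (hA : 0 < A) (t : ℝ) :
    ∫ u : ℝ, Complex.exp (-(4 * t * u) * Complex.I) * besselG b A u =
      ((Gamma b ^ 2 * profile b A t : ℝ) : ℂ) := by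
  set e : ℝ → ℂ := fun x => Complex.exp (-(4 * t * x) * Complex.I) with he
  have hecont : Continuous e := by rw [he]; fun_prop
  have henorm : ∀ x, ‖e x‖ ≤ 1 := by
    intro x
    have : -(4 * (t : ℂ) * x) * Complex.I = ((-(4 * t * x) : ℝ) : ℂ) * Complex.I := by push_cast; ring
    rw [he]; dsimp only
    rw [this, Complex.norm_exp_ofReal_mul_I]
  have hg := (integrable_gammaDens hb hA).ofReal (𝕜 := ℂ)
  have h_int : Integrable (fun z : ℝ × ℝ => e z.2 *
      ((gammaDens b A (z.1 + z.2) * gammaDens b A z.1 : ℝ) : ℂ)) (volume.prod volume) := by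
    refine ((integrable_shear_gammaDens hb hA).ofReal (𝕜 := ℂ)).bdd_mul (c := 1) ?_ ?_
    · exact (hecont.comp continuous_snd).aestronglyMeasurable
    · exact ae_of_all _ fun z => henorm _
  have h1 : ∫ u, e u * besselG b A u =
      ∫ z : ℝ × ℝ, e z.2 * ((gammaDens b A (z.1 + z.2) * gammaDens b A z.1 : ℝ) : ℂ)
        ∂(volume.prod volume) := by
    rw [integral_prod_symm _ h_int]
    congr 1
    ext u
    dsimp only
    rw [integral_const_mul, integral_complex_ofReal, integral_gammaDens_corr]
  rw [h1]
  have h2 : ∫ z : ℝ × ℝ, e z.2 * ((gammaDens b A (z.1 + z.2) * gammaDens b A z.1 : ℝ) : ℂ)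
        ∂(volume.prod volume) =
      ∫ z : ℝ × ℝ, (starRingEnd ℂ (e z.1 * gammaDens b A z.1)) * (e z.2 * gammaDens b A z.2)
        ∂(volume.prod volume) := by
    rw [← (measurePreserving_prod_add (volume : Measure ℝ) (volume : Measure ℝ)).integral_comp
      (MeasurableEquiv.shearAddRight ℝ).measurableEmbedding fun z : ℝ × ℝ =>
        (starRingEnd ℂ (e z.1 * gammaDens b A z.1)) * (e z.2 * gammaDens b A z.2)]
    congr 1
    ext z
    simp only [map_mul, Complex.conj_ofReal, he, ← Complex.exp_conj]
    rw [mul_mul_mul_comm, ← Complex.exp_add]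
    simp only [map_neg, map_mul, Complex.conj_I, Complex.conj_ofReal, Complex.conj_ofNat]
    push_cast
    rw [mul_comm (gammaDens b A (z.1 + z.2) : ℂ)]
    congr 2
    ring
  have h3 := integral_exp_mul_gammaDens hb hA t
  rw [h2, integral_prod_mul (fun x => starRingEnd ℂ (e x * gammaDens b A x))
    fun x => e x * gammaDens b A x, integral_conj, h3, ← Complex.normSq_eq_conj_mul_self,
    Complex.normSq_eq_norm_sq]
  congr 1
  rw [norm_mul, Complex.norm_cpow_real, Complex.Gamma_ofReal, Complex.norm_real, mul_pow, mul_comm]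
  rw [norm_eq_abs, sq_abs]
  congr 1
  have h4 : ‖(1 : ℂ) / (A + 4 * t * Complex.I)‖ = (A ^ 2 + 16 * t ^ 2) ^ (-(1 / 2 : ℝ)) := by
    rw [norm_div, norm_one, rpow_neg (by positivity), ← sqrt_eq_rpow, one_div]
    congr 1
    have : (A : ℂ) + 4 * t * Complex.I = ((A : ℝ) : ℂ) + ((4 * t : ℝ) : ℂ) * Complex.I := by
      push_cast; ring
    rw [this, Complex.norm_add_mul_I]
    congr 1; ring
  rw [h4, profile, ← rpow_natCast, ← rpow_mul (by positivity), ← rpow_mul (by positivity)]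
  congr 1; push_cast; ring

lemma add_rpow_le_three {a y u R : ℝ} (hy : 0 < y) (hu : 0 ≤ u) (huR : u ≤ R) (hR : 0 < R) :
    (y + u) ^ a ≤ y ^ a + (2 * y) ^ a + (2 * R) ^ a := by
  have h1 : 0 < y ^ a := by positivity
  have h2 : 0 < (2 * y) ^ a := by positivity
  have h3 : 0 < (2 * R) ^ a := by positivity
  rcases le_total a 0 with ha | ha
  · have := rpow_le_rpow_of_nonpos hy (by linarith : y ≤ y + u) ha
    linarith
  · rcases le_total y R with h | h
    · have := rpow_le_rpow (by positivity) (by linarith : y + u ≤ 2 * R) ha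
      linarith
    · have := rpow_le_rpow (by positivity) (by linarith : y + u ≤ 2 * y) ha
      linarith

lemma besselKer_le {b A u y R : ℝ} (hA : 0 < A) (hy : 0 < y) (hu : |u| ≤ R) (hR : 0 < R) :
    besselKer b A u y ≤ (1 + 2 ^ (b - 1)) * gammaDens (2 * b - 1) (2 * A) y +
      (2 * R) ^ (b - 1) * gammaDens b (2 * A) y := by
  have h1 := add_rpow_le_three (a := b - 1) hy (abs_nonneg u) hu hR
  unfold besselKer gammaDens
  rw [indicator_of_mem (mem_Ioi.2 hy), indicator_of_mem (mem_Ioi.2 hy),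
    mul_rpow hy.le (by positivity)]
  have h2 : exp (-(A * (2 * y + |u|))) ≤ exp (-(2 * A * y)) := by
    apply exp_le_exp.2
    have : 0 ≤ A * |u| := by positivity
    linarith
  have h3 : y ^ (2 * b - 1 - 1) = y ^ (b - 1) * y ^ (b - 1) := by
    rw [← rpow_add hy]; congr 1; ring
  rw [mul_rpow two_pos.le hy.le] at h1
  rw [h3]
  calc y ^ (b - 1) * (y + |u|) ^ (b - 1) * exp (-(A * (2 * y + |u|)))
      ≤ y ^ (b - 1) * (y ^ (b - 1) + 2 ^ (b - 1) * y ^ (b - 1) + (2 * R) ^ (b - 1)) *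
        exp (-(2 * A * y)) := by gcongr
    _ = _ := by ring

lemma besselKer_nonneg {b A u y : ℝ} (hy : 0 < y) : 0 ≤ besselKer b A u y := by
  unfold besselKer; positivity

lemma measurable_besselKer (b A : ℝ) : Measurable fun z : ℝ × ℝ => besselKer b A z.1 z.2 := by
  unfold besselKer; fun_prop

lemma besselKer_integrableOn {b A : ℝ} (hb : 1 / 2 < b) (hA : 0 < A) (u : ℝ) :
    IntegrableOn (besselKer b A u) (Ioi 0) := by
  have hR : 0 < |u| + 1 := by positivity
  refine Integrable.mono' (g := fun y => (1 + 2 ^ (b - 1)) * gammaDens (2 * b - 1) (2 * A) y +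
    (2 * (|u| + 1)) ^ (b - 1) * gammaDens b (2 * A) y) ?_ ?_ ?_
  · exact (((integrable_gammaDens (by linarith) (by linarith)).const_mul _).add
      ((integrable_gammaDens (by linarith) (by linarith)).const_mul _)).integrableOn
  · exact ((measurable_besselKer b A).comp
      (measurable_const.prodMk measurable_id)).aestronglyMeasurable
  · refine (ae_restrict_iff' measurableSet_Ioi).2 (ae_of_all _ fun y hy => ?_)
    rw [norm_of_nonneg (besselKer_nonneg hy)]
    exact besselKer_le hA hy (by linarith) hR

lemma continuous_besselG {b A : ℝ} (hb : 1 / 2 < b) (hA : 0 < A) : Continuous (besselG b A) := by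
  rw [continuous_iff_continuousAt]
  intro u₀
  set R := |u₀| + 1 with hR
  have hR0 : 0 < R := by positivity
  refine continuousAt_of_dominated (bound := fun y =>
    (1 + 2 ^ (b - 1)) * gammaDens (2 * b - 1) (2 * A) y + (2 * R) ^ (b - 1) * gammaDens b (2 * A) y)
    ?_ ?_ ?_ ?_
  · exact Eventually.of_forall fun u =>
      ((measurable_besselKer b A).comp (measurable_const.prodMk measurable_id)).aestronglyMeasurable
  · have : ∀ᶠ u in 𝓝 u₀, |u| < R :=
      (continuous_abs.tendsto u₀).eventually_lt_const (by rw [hR]; linarith)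
    filter_upwards [this] with u hu
    refine (ae_restrict_iff' measurableSet_Ioi).2 (ae_of_all _ fun y hy => ?_)
    rw [norm_of_nonneg (besselKer_nonneg hy)]
    exact besselKer_le hA hy hu.le hR0
  · exact (((integrable_gammaDens (by linarith) (by linarith)).const_mul _).add
      ((integrable_gammaDens (by linarith) (by linarith)).const_mul _)).integrableOn
  · refine (ae_restrict_iff' measurableSet_Ioi).2 (ae_of_all _ fun y hy => ?_)
    have hy' : (0 : ℝ) < y := hy
    unfold besselKer
    refine ContinuousAt.mul (ContinuousAt.rpow_const (by fun_prop) (Or.inl (by positivity)))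
      (by fun_prop)

lemma profile_nonneg (b A t : ℝ) : 0 ≤ profile b A t := by
  unfold profile; positivity

lemma continuous_profile (b : ℝ) {A : ℝ} (hA : 0 < A) : Continuous (profile b A) := by
  unfold profile
  exact Continuous.rpow_const (by fun_prop) fun t => Or.inl (by positivity)

lemma integrable_profile {b A : ℝ} (hb : 1 / 2 < b) (hA : 0 < A) : Integrable (profile b A) := by
  set m := min (A ^ 2) 16 with hm
  have hm0 : 0 < m := by positivity
  have h1 := integrable_rpow_neg_one_add_norm_sq (E := ℝ) (μ := volume) (r := 2 * b)
    (by simp; linarith)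
  refine Integrable.mono' (h1.const_mul (m ^ (-b)))
    (continuous_profile b hA).aestronglyMeasurable (ae_of_all _ fun t => ?_)
  rw [norm_of_nonneg (profile_nonneg b A t)]
  have h2 : m * (1 + ‖t‖ ^ 2) ≤ A ^ 2 + 16 * t ^ 2 := by
    rw [norm_eq_abs, sq_abs]
    nlinarith [min_le_left (A ^ 2) 16, min_le_right (A ^ 2) 16, sq_nonneg t]
  have h3 : -(2 * b) / 2 = -b := by ring
  rw [h3, ← mul_rpow hm0.le (by positivity)]
  exact rpow_le_rpow_of_nonpos (by positivity) h2 (by linarith)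

lemma integral_exp_mul_profile {b A : ℝ} (hb : 1 / 2 < b) (hA : 0 < A) (u : ℝ) :
    ∫ t : ℝ, Complex.exp (4 * u * t * Complex.I) * profile b A t =
      ((π / 2 * (Gamma b)⁻¹ ^ 2 * besselG b A u : ℝ) : ℂ) := by
  have hb0 : 0 < b := by linarith
  have hG : Gamma b ≠ 0 := (Gamma_pos_of_pos hb0).ne'
  have hF : FourierTransform.fourier (fun u : ℝ => (besselG b A u : ℂ)) =
      fun ξ : ℝ => ((Gamma b ^ 2 * profile b A (π / 2 * ξ) : ℝ) : ℂ) := by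
    ext ξ
    rw [Real.fourier_real_eq_integral_exp_smul, ← integral_exp_mul_besselG hb0 hA]
    refine integral_congr_ae (ae_of_all _ fun v => ?_)
    simp only [smul_eq_mul]
    congr 2
    push_cast
    ring
  have hp2 : (π / 2 : ℝ) ≠ 0 := by positivity
  have h_int : Integrable (FourierTransform.fourier (fun u : ℝ => (besselG b A u : ℂ))) := by
    rw [hF]
    exact (((integrable_profile hb hA).comp_mul_left' hp2).const_mul _).ofReal
  have hinv := Continuous.fourierInv_fourier_eq
    (Complex.continuous_ofReal.comp (continuous_besselG hb hA))
    (integrable_besselG hb0 hA).ofReal h_int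
  have h1 := congrFun hinv u
  simp only [Function.comp_def] at h1
  rw [hF, Real.fourierInv_eq'] at h1
  have h2 := Measure.integral_comp_mul_left
    (fun t : ℝ => Complex.exp (4 * u * t * Complex.I) * profile b A t) (π / 2)
  have h3 : ∫ v : ℝ, Complex.exp ((2 * π * inner ℝ v u : ℝ) * Complex.I) •
      ((Gamma b ^ 2 * profile b A (π / 2 * v) : ℝ) : ℂ) =
      (Gamma b : ℂ) ^ 2 * ∫ x : ℝ, Complex.exp (4 * u * (π / 2 * x : ℝ) * Complex.I) *
        profile b A (π / 2 * x) := by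
    rw [← integral_const_mul]
    refine integral_congr_ae (ae_of_all _ fun v => ?_)
    simp only [smul_eq_mul, RCLike.inner_apply, conj_trivial]
    push_cast
    rw [show (2 * π * (u * v) : ℂ) * Complex.I = 4 * u * (π / 2 * v) * Complex.I by ring]
    ring
  rw [h3, h2, abs_of_pos (by positivity)] at h1
  rw [Complex.real_smul] at h1
  push_cast at h1 ⊢
  have hGc : (Gamma b : ℂ) ≠ 0 := by exact_mod_cast hG
  have hpc : (π : ℂ) ≠ 0 := by exact_mod_cast pi_ne_zero
  generalize ∫ t : ℝ, Complex.exp (4 * u * t * Complex.I) * profile b A t = J at h1 ⊢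
  rw [← h1]
  field_simp

lemma integral_profile_mul_profile {b b' A B : ℝ} (hb : 1 / 2 < b) (hb' : 1 / 2 < b')
    (hA : 0 < A) (hB : 0 < B) (τ : ℝ) :
    ((∫ t : ℝ, profile b A t * profile b' B (τ - t) : ℝ) : ℂ) =
      ((π / 2 * (Gamma b)⁻¹ ^ 2 * (Gamma b')⁻¹ ^ 2 : ℝ) : ℂ) *
        ∫ u : ℝ, Complex.exp (-(4 * τ * u) * Complex.I) *
          ((besselG b A u * besselG b' B u : ℝ) : ℂ) := by
  have hb0 : 0 < b := by linarith
  have hGc : (Gamma b : ℂ) ≠ 0 := by exact_mod_cast (Gamma_pos_of_pos hb0).ne'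
  set F : ℝ → ℝ → ℂ := fun t u => Complex.exp (-(4 * t * u) * Complex.I) *
    ((profile b' B (τ - t) * besselG b A u : ℝ) : ℂ) with hF
  have h_int : Integrable (Function.uncurry F) (volume.prod volume) := by
    have h1 : Integrable (fun z : ℝ × ℝ => profile b' B (τ - z.1) * besselG b A z.2)
        (volume.prod volume) :=
      ((integrable_profile hb' hB).comp_sub_left τ).mul_prod (integrable_besselG hb0 hA)
    refine h1.ofReal.bdd_mul (c := 1) (f := fun z : ℝ × ℝ =>
      Complex.exp (-(4 * z.1 * z.2) * Complex.I)) ?_ ?_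
    · exact (by fun_prop : Continuous fun z : ℝ × ℝ =>
        Complex.exp (-(4 * z.1 * z.2) * Complex.I)).aestronglyMeasurable
    · refine ae_of_all _ fun z => le_of_eq ?_
      have := Complex.norm_exp_ofReal_mul_I (-(4 * z.1 * z.2))
      push_cast at this
      exact this
  have h1 : ((∫ t : ℝ, profile b A t * profile b' B (τ - t) : ℝ) : ℂ) =
      (Gamma b : ℂ)⁻¹ ^ 2 * ∫ t, ∫ u, F t u := by
    rw [← integral_complex_ofReal, ← integral_const_mul]
    refine integral_congr_ae (ae_of_all _ fun t => ?_)
    have h := integral_exp_mul_besselG hb0 hA t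
    have h2 : ∫ u, F t u = profile b' B (τ - t) *
        ∫ u : ℝ, Complex.exp (-(4 * t * u) * Complex.I) * besselG b A u := by
      rw [← integral_const_mul]
      refine integral_congr_ae (ae_of_all _ fun u => ?_)
      simp only [hF]
      push_cast
      ring
    simp only []
    rw [h2, h]
    push_cast
    field_simp
  have h3 : ∀ u, ∫ t, F t u = ((π / 2 * (Gamma b')⁻¹ ^ 2 : ℝ) : ℂ) *
      (Complex.exp (-(4 * τ * u) * Complex.I) * ((besselG b A u * besselG b' B u : ℝ) : ℂ)) := by
    intro u
    have h4 := integral_sub_left_eq_self (fun t : ℝ =>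
      Complex.exp (-(4 * τ * u) * Complex.I) * besselG b A u *
        (Complex.exp (4 * u * t * Complex.I) * profile b' B t)) volume τ
    rw [integral_const_mul (f := fun t : ℝ => Complex.exp (4 * u * t * Complex.I) * profile b' B t),
      integral_exp_mul_profile hb' hB u] at h4
    refine (integral_congr_ae (ae_of_all _ fun t => ?_)).trans (h4.trans (by push_cast; ring))
    simp only [hF]
    have h5 : Complex.exp (-(4 * t * u) * Complex.I) = Complex.exp (-(4 * τ * u) * Complex.I) *
        Complex.exp (4 * u * (τ - t : ℝ) * Complex.I) := by
      rw [← Complex.exp_add]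
      congr 1
      push_cast
      ring
    rw [h5]
    push_cast
    ring
  rw [h1, integral_integral_swap h_int]
  simp_rw [h3]
  rw [integral_const_mul, ← mul_assoc]
  congr 1
  push_cast
  ring

lemma integrable_profile_mul_profile {b b' A B : ℝ} (hb : 1 / 2 < b) (hb' : 1 / 2 < b')
    (hA : 0 < A) (hB : 0 < B) (τ : ℝ) :
    Integrable fun t : ℝ => profile b A t * profile b' B (τ - t) := by
  refine ((integrable_profile hb' hB).comp_sub_left τ).bdd_mul (c := (A ^ 2) ^ (-b))
    (continuous_profile b hA).aestronglyMeasurable (ae_of_all _ fun t => ?_)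
  rw [norm_of_nonneg (profile_nonneg _ _ _)]
  exact rpow_le_rpow_of_nonpos (by positivity) (by nlinarith [sq_nonneg t]) (by linarith)

lemma integral_profile {b A : ℝ} (hb : 1 / 2 < b) (hA : 0 < A) :
    ∫ t : ℝ, profile b A t = π / 2 * (Gamma b)⁻¹ ^ 2 *
      ∫ y in Ioi 0, y ^ (2 * b - 2) * exp (-(2 * A * y)) := by
  have h := integral_exp_mul_profile hb hA 0
  simp only [Complex.ofReal_zero, mul_zero, zero_mul, Complex.exp_zero, one_mul] at h
  rw [integral_complex_ofReal] at h
  rw [Complex.ofReal_inj.1 h]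
  congr 1
  refine setIntegral_congr_fun measurableSet_Ioi fun y hy => ?_
  have hy' : (0 : ℝ) < y := hy
  simp only [besselKer, abs_zero, add_zero]
  rw [mul_rpow hy'.le hy'.le, ← rpow_add hy']
  congr 2 <;> ring

lemma integrableOn_rpow_mul_exp {a r : ℝ} (ha : 0 < a) (hr : 0 < r) :
    IntegrableOn (fun y : ℝ => y ^ (a - 1) * exp (-(r * y))) (Ioi 0) := by
  have := integrableOn_rpow_mul_exp_neg_mul_rpow (p := 1) (s := a - 1) (b := r)
    (by linarith) one_pos hr
  simpa using this

lemma lintegral_rpow_mul_exp {a r : ℝ} (ha : 0 < a) (hr : 0 < r) :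
    ∫⁻ y in Ioi 0, ENNReal.ofReal (y ^ (a - 1) * exp (-(r * y))) =
      ENNReal.ofReal (Gamma a * r ^ (-a)) := by
  rw [← ofReal_integral_eq_lintegral_ofReal (integrableOn_rpow_mul_exp ha hr)
    ((ae_restrict_iff' measurableSet_Ioi).2 (ae_of_all _ fun y hy => ?_)),
    integral_rpow_mul_exp_neg_mul_Ioi ha hr]
  · rw [one_div, inv_rpow hr.le, rpow_neg hr.le, mul_comm]
  · have hy' : (0 : ℝ) < y := hy
    simp only [Pi.zero_apply]
    positivity

lemma lintegral_profile {b A : ℝ} (hb : 1 / 2 < b) (hA : 0 < A) :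
    ∫⁻ t : ℝ, ENNReal.ofReal (profile b A t) = ENNReal.ofReal (π / 2 * (Gamma b)⁻¹ ^ 2) *
      ∫⁻ y in Ioi 0, ENNReal.ofReal (y ^ (2 * b - 2) * exp (-(2 * A * y))) := by
  rw [← ofReal_integral_eq_lintegral_ofReal (integrable_profile hb hA)
    (ae_of_all _ fun t => profile_nonneg b A t), integral_profile hb hA,
    ENNReal.ofReal_mul (by positivity)]
  congr 1
  refine ofReal_integral_eq_lintegral_ofReal ?_ ?_
  · have := integrableOn_rpow_mul_exp (a := 2 * b - 1) (r := 2 * A) (by linarith) (by linarith)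
    rwa [show 2 * b - 1 - 1 = 2 * b - 2 by ring] at this
  · refine (ae_restrict_iff' measurableSet_Ioi).2 (ae_of_all _ fun y hy => ?_)
    have hy' : (0 : ℝ) < y := hy
    simp only [Pi.zero_apply]
    positivity

lemma profile_anti {b A B : ℝ} (hb : 0 ≤ b) (hA : 0 < A) (hAB : A ≤ B) (t : ℝ) :
    profile b B t ≤ profile b A t := by
  refine rpow_le_rpow_of_nonpos (by positivity) ?_ (by linarith)
  nlinarith

lemma lintegral_profile_sub {b A B : ℝ} (hb : 1 / 2 < b) (hA : 0 < A) (hAB : A ≤ B) :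
    ∫⁻ t : ℝ, ENNReal.ofReal (profile b A t - profile b B t) =
      ENNReal.ofReal (π / 2 * (Gamma b)⁻¹ ^ 2) *
      ∫⁻ y in Ioi 0, ENNReal.ofReal (y ^ (2 * b - 2) *
        (exp (-(2 * A * y)) - exp (-(2 * B * y)))) := by
  have hB : 0 < B := hA.trans_le hAB
  have hi : ∀ {C : ℝ}, 0 < C →
      IntegrableOn (fun y : ℝ => y ^ (2 * b - 2) * exp (-(2 * C * y))) (Ioi 0) := by
    intro C hC
    have := integrableOn_rpow_mul_exp (a := 2 * b - 1) (r := 2 * C) (by linarith) (by linarith)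
    rwa [show 2 * b - 1 - 1 = 2 * b - 2 by ring] at this
  rw [← ofReal_integral_eq_lintegral_ofReal (f := fun t => profile b A t - profile b B t)
      ((integrable_profile hb hA).sub (integrable_profile hb hB))
    (ae_of_all _ fun t => sub_nonneg.2 (profile_anti (by linarith) hA hAB t)),
    integral_sub (integrable_profile hb hA) (integrable_profile hb hB),
    integral_profile hb hA, integral_profile hb hB, ← mul_sub,
    ENNReal.ofReal_mul (by positivity), ← integral_sub (hi hA) (hi hB)]
  congr 1
  simp_rw [mul_sub]
  refine ofReal_integral_eq_lintegral_ofReal ((hi hA).sub (hi hB)) ?_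
  refine (ae_restrict_iff' measurableSet_Ioi).2 (ae_of_all _ fun y hy => ?_)
  have hy' : (0 : ℝ) < y := hy
  simp only [Pi.zero_apply]
  rw [← mul_sub]
  refine mul_nonneg (by positivity) (sub_nonneg.2 (exp_le_exp.2 ?_))
  nlinarith

lemma integral_cexp_neg_mul_norm_sq_add_sum {n : ℕ} {r : ℝ} (hr : 0 < r) (c : Fin n → ℂ) :
    ∫ x : EuclideanSpace ℝ (Fin n), Complex.exp (-r * (‖x‖ : ℂ) ^ 2 + ∑ i, c i * x i) =
      (π / r : ℂ) ^ (n / 2 : ℂ) * Complex.exp ((∑ i, c i ^ 2) / (4 * r)) := by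
  have h := GaussianFourier.integral_cexp_neg_mul_sum_add (b := (r : ℂ)) (by simpa using hr) c
  rw [← (PiLp.volume_preserving_toLp (Fin n)).integral_comp
    (MeasurableEquiv.toLp 2 (Fin n → ℝ)).measurableEmbedding, Fintype.card_fin] at *
  rw [← h]
  refine integral_congr_ae (ae_of_all _ fun x => ?_)
  simp only
  congr 3
  rw [← Complex.ofReal_pow, EuclideanSpace.norm_sq_eq]
  simp

/-- The product of a Gaussian centred at `0` and a Gaussian centred at `w`. -/
def gaussPair {n : ℕ} (α β : ℝ)
    (w v : EuclideanSpace ℝ (Fin n) × EuclideanSpace ℝ (Fin n)) : ℝ :=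
  exp (-(α * (‖v.1‖ ^ 2 + ‖v.2‖ ^ 2) + β * (‖w.1 - v.1‖ ^ 2 + ‖w.2 - v.2‖ ^ 2)))

/-- The standard symplectic form on `ℝⁿ × ℝⁿ`. -/
def sympl {n : ℕ} (v w : EuclideanSpace ℝ (Fin n) × EuclideanSpace ℝ (Fin n)) : ℝ :=
  ∑ j, (v.1 j * w.2 j - v.2 j * w.1 j)

lemma gaussPair_pos {n : ℕ} (α β : ℝ)
    (w v : EuclideanSpace ℝ (Fin n) × EuclideanSpace ℝ (Fin n)) : 0 < gaussPair α β w v :=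
  exp_pos _

lemma integral_cexp_mul_gaussPair {n : ℕ} {α β : ℝ} (h : 0 < α + β) (u : ℝ)
    (w : EuclideanSpace ℝ (Fin n) × EuclideanSpace ℝ (Fin n)) :
    ∫ v, Complex.exp (-(2 * u * sympl v w) * Complex.I) * gaussPair α β w v =
      (((π / (α + β)) ^ n * exp (-((‖w.1‖ ^ 2 + ‖w.2‖ ^ 2) * ((α * β + u ^ 2) / (α + β)))) : ℝ) :
        ℂ) := by
  set c : Fin n → ℂ := fun j => 2 * β * w.1 j - 2 * u * w.2 j * Complex.I with hc
  set d : Fin n → ℂ := fun j => 2 * β * w.2 j + 2 * u * w.1 j * Complex.I with hd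
  set r : ℝ := α + β with hr
  have hnorm : ∀ x : EuclideanSpace ℝ (Fin n), (‖x‖ : ℂ) ^ 2 = ∑ i, (x i : ℂ) ^ 2 := by
    intro x
    rw [← Complex.ofReal_pow, EuclideanSpace.norm_sq_eq]
    simp
  have hprod := integral_prod_mul (μ := (volume : Measure (EuclideanSpace ℝ (Fin n))))
    (ν := (volume : Measure (EuclideanSpace ℝ (Fin n))))
    (fun x => Complex.exp (-r * (‖x‖ : ℂ) ^ 2 + ∑ i, c i * x i))
    (fun y => Complex.exp (-r * (‖y‖ : ℂ) ^ 2 + ∑ i, d i * y i))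
  rw [integral_cexp_neg_mul_norm_sq_add_sum h, integral_cexp_neg_mul_norm_sq_add_sum h,
    ← Measure.volume_eq_prod] at hprod
  have hpt : ∀ v : EuclideanSpace ℝ (Fin n) × EuclideanSpace ℝ (Fin n),
      Complex.exp (-(2 * u * sympl v w) * Complex.I) * gaussPair α β w v =
      Complex.exp (-β * ((‖w.1‖ : ℂ) ^ 2 + (‖w.2‖ : ℂ) ^ 2)) *
        (Complex.exp (-r * (‖v.1‖ : ℂ) ^ 2 + ∑ i, c i * v.1 i) *
          Complex.exp (-r * (‖v.2‖ : ℂ) ^ 2 + ∑ i, d i * v.2 i)) := by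
    intro v
    unfold gaussPair sympl
    rw [Complex.ofReal_exp, ← Complex.exp_add, ← Complex.exp_add, ← Complex.exp_add]
    congr 1
    push_cast
    simp only [hnorm]
    simp only [Finset.mul_sum, Finset.sum_mul, ← Finset.sum_add_distrib, ← Finset.sum_neg_distrib]
    refine Finset.sum_congr rfl fun i _ => ?_
    simp only [hc, hd, hr, PiLp.sub_apply]
    push_cast
    ring
  simp_rw [hpt]
  rw [integral_const_mul, hprod]
  have hr0 : (r : ℂ) ≠ 0 := by exact_mod_cast h.ne'
  have hpow : (π / r : ℂ) ^ (n / 2 : ℂ) * (π / r : ℂ) ^ (n / 2 : ℂ) = (π / r) ^ n := by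
    rw [← Complex.cpow_add _ _ (div_ne_zero (by exact_mod_cast pi_ne_zero) hr0), add_halves,
      Complex.cpow_natCast]
  have hexp : Complex.exp (-β * ((‖w.1‖ : ℂ) ^ 2 + (‖w.2‖ : ℂ) ^ 2)) *
      (Complex.exp ((∑ i, c i ^ 2) / (4 * r)) * Complex.exp ((∑ i, d i ^ 2) / (4 * r))) =
      Complex.exp (-((‖w.1‖ ^ 2 + ‖w.2‖ ^ 2) * ((α * β + u ^ 2) / r) : ℝ)) := by
    rw [← Complex.exp_add, ← Complex.exp_add]
    congr 1
    have hcd : (∑ i, c i ^ 2) + ∑ i, d i ^ 2 =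
        (4 * β ^ 2 - 4 * u ^ 2) * ((‖w.1‖ : ℂ) ^ 2 + (‖w.2‖ : ℂ) ^ 2) := by
      simp only [hnorm, Finset.mul_sum, ← Finset.sum_add_distrib]
      refine Finset.sum_congr rfl fun i _ => ?_
      simp only [hc, hd]
      ring_nf
      rw [Complex.I_sq]
      ring
    rw [← add_div, hcd]
    push_cast
    field_simp
    rw [hr]
    push_cast
    ring
  calc _ = ((π / r : ℂ) ^ (n / 2 : ℂ) * (π / r : ℂ) ^ (n / 2 : ℂ)) *
      (Complex.exp (-β * ((‖w.1‖ : ℂ) ^ 2 + (‖w.2‖ : ℂ) ^ 2)) *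
      (Complex.exp ((∑ i, c i ^ 2) / (4 * r)) * Complex.exp ((∑ i, d i ^ 2) / (4 * r)))) := by ring
    _ = _ := by
      rw [hpow, hexp]
      push_cast
      rfl

lemma integral_gaussPair {n : ℕ} {α β : ℝ} (h : 0 < α + β)
    (w : EuclideanSpace ℝ (Fin n) × EuclideanSpace ℝ (Fin n)) :
    ∫ v, gaussPair α β w v =
      (π / (α + β)) ^ n * exp (-((‖w.1‖ ^ 2 + ‖w.2‖ ^ 2) * ((α * β) / (α + β)))) := by
  have := integral_cexp_mul_gaussPair h 0 w
  simp only [Complex.ofReal_zero, mul_zero, zero_mul, neg_zero, Complex.exp_zero, one_mul] at this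
  rw [integral_complex_ofReal] at this
  rw [Complex.ofReal_inj.1 this]
  simp

lemma integrable_gaussPair {n : ℕ} {α β : ℝ} (h : 0 < α + β)
    (w : EuclideanSpace ℝ (Fin n) × EuclideanSpace ℝ (Fin n)) : Integrable (gaussPair α β w) := by
  refine Integrable.of_integral_ne_zero ?_
  rw [integral_gaussPair h]
  positivity

lemma lintegral_gaussPair {n : ℕ} {α β : ℝ} (h : 0 < α + β)
    (w : EuclideanSpace ℝ (Fin n) × EuclideanSpace ℝ (Fin n)) :
    ∫⁻ v, ENNReal.ofReal (gaussPair α β w v) = ENNReal.ofReal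
      ((π / (α + β)) ^ n * exp (-((‖w.1‖ ^ 2 + ‖w.2‖ ^ 2) * ((α * β) / (α + β))))) := by
  rw [← integral_gaussPair h, ofReal_integral_eq_lintegral_ofReal (integrable_gaussPair h w)
    (ae_of_all _ fun v => (gaussPair_pos _ _ _ _).le)]

lemma lintegral_exp_neg_mul_norm_sq {n : ℕ} {r : ℝ} (hr : 0 < r) :
    ∫⁻ v : EuclideanSpace ℝ (Fin n) × EuclideanSpace ℝ (Fin n),
      ENNReal.ofReal (exp (-(r * (‖v.1‖ ^ 2 + ‖v.2‖ ^ 2)))) = ENNReal.ofReal ((π / r) ^ n) := by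
  have := lintegral_gaussPair (n := n) (α := r) (β := 0) (by simpa using hr) 0
  simpa [gaussPair] using this

lemma lintegral_Ioi_eq_lintegral_Ioo {z m : ℝ} (hz : 0 < z) (hm : 0 ≤ m) (F : ℝ → ℝ≥0∞) :
    ∫⁻ y in Ioi 0, F y = ∫⁻ σ in Ioo 0 z, ENNReal.ofReal (z * (z + m) / (z - σ) ^ 2) *
      F (σ * (z + m) / (z - σ)) := by
  set g : ℝ → ℝ := fun σ => σ * (z + m) / (z - σ) with hg
  have him : g '' Ioo 0 z = Ioi 0 := by
    ext y
    simp only [mem_image, mem_Ioo, mem_Ioi, hg]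
    constructor
    · rintro ⟨σ, ⟨h0, h1⟩, rfl⟩
      have : 0 < z - σ := by linarith
      positivity
    · intro hy
      have h1 : 0 < y + z + m := by positivity
      refine ⟨y * z / (y + z + m), ⟨by positivity, ?_⟩, ?_⟩
      · rw [div_lt_iff₀ h1]
        nlinarith [mul_nonneg hz.le hm, mul_pos hz hz]
      · have h2 : z - y * z / (y + z + m) = z * (z + m) / (y + z + m) := by
          field_simp
          ring
        rw [h2]
        have : 0 < z + m := by positivity
        field_simp
  have hder : ∀ σ ∈ Ioo 0 z, HasDerivWithinAt g (z * (z + m) / (z - σ) ^ 2) (Ioo 0 z) σ := by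
    intro σ hσ
    have h1 : z - σ ≠ 0 := by linarith [hσ.2]
    have h2 := ((hasDerivAt_id σ).mul_const (z + m)).div ((hasDerivAt_id σ).const_sub z) h1
    refine (h2.congr_deriv ?_).hasDerivWithinAt
    simp only [id]
    congr 1
    ring
  have hinj : InjOn g (Ioo 0 z) := by
    intro x hx y hy hxy
    simp only [hg] at hxy
    have h1 : z - x ≠ 0 := by linarith [hx.2]
    have h2 : z - y ≠ 0 := by linarith [hy.2]
    have h3 : 0 < z * (z + m) := by positivity
    rw [div_eq_div_iff h1 h2] at hxy
    have h4 : z * (z + m) * (x - y) = 0 := by linarith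
    rcases mul_eq_zero.1 h4 with h | h
    · exact absurd h h3.ne'
    · linarith
  have h := lintegral_image_eq_lintegral_abs_deriv_mul measurableSet_Ioo hder hinj F
  rw [him] at h
  rw [h]
  refine setLIntegral_congr_fun measurableSet_Ioo fun σ hσ => ?_
  have h1 : 0 < z - σ := by linarith [hσ.2]
  rw [abs_of_nonneg (by positivity)]

lemma kernel_subst_identity {n : ℕ} {s b b' m z σ : ℝ} (hm : 0 ≤ m) (hσ : 0 < σ) (hz : σ < z)
    (hb : b = (n + 1 - s) / 2) (hb' : b' = (n + 1 + s) / 2) :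
    z * (z + m) / (z - σ) ^ 2 *
      ((σ * (z + m) / (z - σ) * (σ * (z + m) / (z - σ) + m)) ^ (b - 1) * (z * (z + m)) ^ (b' - 1) *
        (π / (2 * (σ * (z + m) / (z - σ) + z + m))) ^ n) =
    (π / 2) ^ n * ((σ * (σ + m)) ^ (b - 1) * (z - σ) ^ (s - 1)) := by
  have hw : 0 < z - σ := by linarith
  have hz0 : 0 < z := by linarith
  have hZ : 0 < z * (z + m) := by positivity
  have hS : 0 < σ * (σ + m) := by positivity
  have h1 : σ * (z + m) / (z - σ) * (σ * (z + m) / (z - σ) + m) =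
      σ * (σ + m) * (z * (z + m)) / (z - σ) ^ 2 := by
    field_simp
    ring
  have h2 : π / (2 * (σ * (z + m) / (z - σ) + z + m)) = π / 2 * ((z - σ) / (z * (z + m))) := by
    have h3 : σ * (z + m) / (z - σ) + z + m = z * (z + m) / (z - σ) := by
      field_simp
      ring
    rw [h3]
    field_simp
  rw [h1, h2]
  generalize z * (z + m) = Z at *
  generalize σ * (σ + m) = S at *
  generalize z - σ = w at *
  rw [div_rpow (by positivity) (by positivity), mul_rpow hS.le hZ.le, mul_pow, div_pow w,
    ← rpow_natCast w n, ← rpow_natCast Z n, ← rpow_natCast w 2, ← rpow_mul hw.le]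
  push_cast
  have e1 : Z ^ (b - 1) = Z ^ (n : ℝ) / (Z * Z ^ (b' - 1)) := by
    rw [eq_div_iff (by positivity)]
    nth_rewrite 2 [← rpow_one Z]
    rw [← rpow_add hZ, ← rpow_add hZ]
    congr 1
    rw [hb, hb']
    ring
  have e2 : w ^ (s - 1) = w ^ (n : ℝ) / (w ^ (2 : ℝ) * w ^ (2 * (b - 1))) := by
    rw [eq_div_iff (by positivity), ← rpow_add hw, ← rpow_add hw]
    congr 1
    rw [hb]
    ring
  rw [e1, e2]
  have : 0 < w ^ (n : ℝ) := by positivity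
  have : 0 < Z ^ (n : ℝ) := by positivity
  field_simp

lemma lintegral_Ioi_sub_rpow_mul_exp {s ρ m σ : ℝ} (hs : 0 < s) (hρ : 0 < ρ) :
    ∫⁻ z in Ioi σ, ENNReal.ofReal ((z - σ) ^ (s - 1) * exp (-(ρ ^ 2 * (2 * z + m)))) =
      ENNReal.ofReal (Gamma s * (2 * ρ ^ 2) ^ (-s) * exp (-(ρ ^ 2 * (2 * σ + m)))) := by
  have hr : 0 < 2 * ρ ^ 2 := by positivity
  have hpre : (fun w : ℝ => w + σ) ⁻¹' Ioi σ = Ioi 0 := by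
    ext w
    simp
  have h := (measurePreserving_add_right (volume : Measure ℝ) σ).setLIntegral_comp_preimage_emb
    (measurableEmbedding_addRight σ)
    (fun z => ENNReal.ofReal ((z - σ) ^ (s - 1) * exp (-(ρ ^ 2 * (2 * z + m))))) (Ioi σ)
  rw [hpre] at h
  rw [← h, mul_comm (Gamma s * _), ENNReal.ofReal_mul (exp_pos _).le,
    ← lintegral_rpow_mul_exp hs hr, ← lintegral_const_mul _ (by fun_prop)]
  refine setLIntegral_congr_fun measurableSet_Ioi fun w hw => ?_
  rw [← ENNReal.ofReal_mul (exp_pos _).le]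
  congr 1
  rw [add_sub_cancel_right, mul_left_comm, ← exp_add]
  congr 2
  ring

lemma lintegral_kernel_subst {n : ℕ} {s b b' m ρ : ℝ} (hs : 0 < s) (hρ : 0 < ρ) (hm : 0 ≤ m)
    (hb : b = (n + 1 - s) / 2) (hb' : b' = (n + 1 + s) / 2) {h : ℝ → ℝ≥0∞} (hh : Measurable h) :
    ∫⁻ z in Ioi 0, ∫⁻ y in Ioi 0, ENNReal.ofReal ((y * (y + m)) ^ (b - 1) *
        (z * (z + m)) ^ (b' - 1) * (π / (2 * (y + z + m))) ^ n * exp (-(ρ ^ 2 * (2 * z + m)))) *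
        h (y * z / (y + z + m)) =
      ENNReal.ofReal ((π / 2) ^ n * (Gamma s * (2 * ρ ^ 2) ^ (-s))) *
        ∫⁻ σ in Ioi 0, ENNReal.ofReal ((σ * (σ + m)) ^ (b - 1) * exp (-(ρ ^ 2 * (2 * σ + m)))) *
          h σ := by
  set G : ℝ → ℝ → ℝ≥0∞ := fun z σ => ENNReal.ofReal ((π / 2) ^ n * ((σ * (σ + m)) ^ (b - 1) *
    (z - σ) ^ (s - 1)) * exp (-(ρ ^ 2 * (2 * z + m)))) * h σ with hG
  have hGm : Measurable (Function.uncurry G) := by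
    simp only [hG, Function.uncurry_def]
    fun_prop
  have h1 : ∀ z ∈ Ioi (0 : ℝ), ∫⁻ y in Ioi 0, ENNReal.ofReal ((y * (y + m)) ^ (b - 1) *
        (z * (z + m)) ^ (b' - 1) * (π / (2 * (y + z + m))) ^ n * exp (-(ρ ^ 2 * (2 * z + m)))) *
        h (y * z / (y + z + m)) = ∫⁻ σ in Ioi 0, (Ioi σ).indicator (fun z => G z σ) z := by
    intro z hz
    have hz' : (0 : ℝ) < z := hz
    rw [lintegral_Ioi_eq_lintegral_Ioo hz' hm]
    have : ∀ σ, (Ioi σ).indicator (fun z => G z σ) z = (Iio z).indicator (G z) σ := by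
      intro σ
      by_cases h : σ < z
      · rw [indicator_of_mem (mem_Ioi.2 h), indicator_of_mem (mem_Iio.2 h)]
      · rw [indicator_of_notMem (by simpa using h), indicator_of_notMem (by simpa using h)]
    simp_rw [this]
    rw [lintegral_indicator measurableSet_Iio, Measure.restrict_restrict measurableSet_Iio,
      inter_comm, Ioi_inter_Iio]
    refine setLIntegral_congr_fun measurableSet_Ioo fun σ hσ => ?_
    have hw : 0 < z - σ := by linarith [hσ.2]
    simp only [hG]
    rw [← mul_assoc, ← ENNReal.ofReal_mul (by positivity), ← mul_assoc]
    rw [kernel_subst_identity hm hσ.1 hσ.2 hb hb']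
    congr 2
    have h3 : σ * (z + m) / (z - σ) + z + m = z * (z + m) / (z - σ) := by
      field_simp
      ring
    have : 0 < z + m := by positivity
    rw [h3]
    field_simp
  rw [setLIntegral_congr_fun measurableSet_Ioi h1, lintegral_lintegral_swap,
    ← lintegral_const_mul _ (by fun_prop)]
  · refine setLIntegral_congr_fun measurableSet_Ioi fun σ hσ => ?_
    have hσ' : (0 : ℝ) < σ := hσ
    rw [lintegral_indicator measurableSet_Ioi, Measure.restrict_restrict measurableSet_Ioi,
      Ioi_inter_Ioi, sup_of_le_left hσ'.le]
    have h4 : ∀ z ∈ Ioi σ, G z σ = ENNReal.ofReal ((π / 2) ^ n * (σ * (σ + m)) ^ (b - 1)) * h σ *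
        ENNReal.ofReal ((z - σ) ^ (s - 1) * exp (-(ρ ^ 2 * (2 * z + m)))) := by
      intro z hz
      have hw : 0 < z - σ := by linarith [mem_Ioi.1 hz]
      simp only [hG]
      rw [mul_right_comm (ENNReal.ofReal _), ← ENNReal.ofReal_mul (by positivity)]
      congr 2
      ring
    rw [setLIntegral_congr_fun measurableSet_Ioi h4, lintegral_const_mul _ (by fun_prop),
      lintegral_Ioi_sub_rpow_mul_exp hs hρ, mul_right_comm (ENNReal.ofReal _),
      ← ENNReal.ofReal_mul (by positivity),
      ← mul_assoc (ENNReal.ofReal _), ← ENNReal.ofReal_mul (by have := Gamma_pos_of_pos hs; positivity)]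
    congr 2
    ring
  · refine Measurable.aemeasurable ?_
    have : (Function.uncurry fun z σ => (Ioi σ).indicator (fun z => G z σ) z) =
        {p : ℝ × ℝ | p.2 < p.1}.indicator (Function.uncurry G) := by
      ext p
      by_cases h : p.2 < p.1
      · rw [indicator_of_mem (by exact h)]
        simp [Function.uncurry, h]
      · rw [indicator_of_notMem (by exact h)]
        simp only [Function.uncurry]
        rw [indicator_of_notMem (by simpa using h)]
    rw [this]
    exact hGm.indicator (measurableSet_lt measurable_snd measurable_fst)

/-- The squared Euclidean norm on `ℝⁿ × ℝⁿ`. -/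
def nsq {n : ℕ} (v : EuclideanSpace ℝ (Fin n) × EuclideanSpace ℝ (Fin n)) : ℝ :=
  ‖v.1‖ ^ 2 + ‖v.2‖ ^ 2

lemma nsq_nonneg {n : ℕ} (v : EuclideanSpace ℝ (Fin n) × EuclideanSpace ℝ (Fin n)) :
    0 ≤ nsq v := by
  unfold nsq; positivity

lemma continuous_nsq {n : ℕ} : Continuous (nsq (n := n)) := by
  unfold nsq; fun_prop

lemma continuous_sympl {n : ℕ}
    (w : EuclideanSpace ℝ (Fin n) × EuclideanSpace ℝ (Fin n)) :
    Continuous fun v => sympl v w := by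
  unfold sympl; fun_prop

lemma measurable_besselKer_param (b : ℝ) :
    Measurable fun z : ℝ × ℝ × ℝ => besselKer b z.1 z.2.1 z.2.2 := by
  unfold besselKer; fun_prop

lemma measurable_besselG (b : ℝ) : Measurable fun z : ℝ × ℝ => besselG b z.1 z.2 := by
  unfold besselG
  have h : StronglyMeasurable (Function.uncurry fun (z : ℝ × ℝ) (y : ℝ) =>
      besselKer b z.1 z.2 y) := by
    refine Measurable.stronglyMeasurable ?_
    exact (measurable_besselKer_param b).comp
      (measurable_fst.fst.prodMk (measurable_fst.snd.prodMk measurable_snd))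
  exact h.integral_prod_right.measurable

/-- The measure on the quadrant carrying the double integral representing a product of two
`besselG`. -/
def quadMeasure : Measure (ℝ × ℝ) :=
  (volume.restrict (Ioi (0 : ℝ))).prod (volume.restrict (Ioi (0 : ℝ)))

instance : SFinite quadMeasure := by unfold quadMeasure; infer_instance

lemma ae_quadMeasure : ∀ᵐ z ∂quadMeasure, 0 < z.1 ∧ 0 < z.2 := by
  unfold quadMeasure
  rw [Measure.prod_restrict]
  refine (ae_restrict_iff' (measurableSet_Ioi.prod measurableSet_Ioi)).2 (ae_of_all _ fun z hz => ?_)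
  exact ⟨hz.1, hz.2⟩

/-- The part of the double integrand that does not depend on the horizontal variable. -/
def quadKer (b b' ρ m : ℝ) (z : ℝ × ℝ) : ℝ :=
  (z.2 * (z.2 + m)) ^ (b - 1) * (z.1 * (z.1 + m)) ^ (b' - 1) * exp (-(ρ ^ 2 * (2 * z.1 + m)))

lemma besselG_mul_besselG {n : ℕ} (b b' ρ u : ℝ)
    (w v : EuclideanSpace ℝ (Fin n) × EuclideanSpace ℝ (Fin n)) :
    besselG b (nsq v) u * besselG b' (ρ ^ 2 + nsq (w - v)) u =
      ∫ z, quadKer b b' ρ |u| z * gaussPair (2 * z.2 + |u|) (2 * z.1 + |u|) w v ∂quadMeasure := by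
  rw [mul_comm]
  unfold besselG quadMeasure
  rw [← integral_prod_mul]
  refine integral_congr_ae (ae_of_all _ fun z => ?_)
  simp only [besselKer, quadKer, gaussPair, nsq]
  rw [mul_mul_mul_comm, ← exp_add, mul_assoc (_ * _) (exp _) (exp _), ← exp_add,
    mul_comm ((z.1 * _) ^ _)]
  congr 2
  simp only [Prod.fst_sub, Prod.snd_sub]
  ring

lemma quadKer_nonneg {b b' ρ m : ℝ} (hm : 0 ≤ m) {z : ℝ × ℝ} (h1 : 0 < z.1) (h2 : 0 < z.2) :
    0 ≤ quadKer b b' ρ m z := by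
  unfold quadKer; positivity

lemma measurable_quadKer (b b' ρ m : ℝ) : Measurable (quadKer b b' ρ m) := by
  unfold quadKer; fun_prop

lemma lintegral_quadKer {n : ℕ} {s b b' ρ m : ℝ} (hs : 0 < s) (hρ : 0 < ρ) (hm : 0 ≤ m)
    (hb : b = (n + 1 - s) / 2) (hb' : b' = (n + 1 + s) / 2) (hb2 : 1 / 2 < b) {X : ℝ}
    (hX : 0 ≤ X) :
    ∫⁻ z, ENNReal.ofReal (quadKer b b' ρ m z * ((π / (2 * z.2 + m + (2 * z.1 + m))) ^ n *
      exp (-(X * (((2 * z.2 + m) * (2 * z.1 + m) + m ^ 2) / (2 * z.2 + m + (2 * z.1 + m)))))))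
        ∂quadMeasure =
      ENNReal.ofReal ((π / 2) ^ n * (Gamma s * (2 * ρ ^ 2) ^ (-s)) * besselG b (ρ ^ 2 + X) m) := by
  have hρX : 0 < ρ ^ 2 + X := by positivity
  have h := lintegral_kernel_subst (n := n) (m := m) hs hρ hm hb hb'
    (h := fun σ => ENNReal.ofReal (exp (-(X * (2 * σ + m))))) (by fun_prop)
  have hΓ := Gamma_pos_of_pos hs
  unfold quadMeasure
  rw [lintegral_prod _ ?_]
  swap
  · refine Measurable.aemeasurable ?_
    have := measurable_quadKer b b' ρ m
    fun_prop
  rw [ENNReal.ofReal_mul (by positivity), besselG, ofReal_integral_eq_lintegral_ofReal]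
  · refine Eq.trans (setLIntegral_congr_fun measurableSet_Ioi fun z hz => ?_) (h.trans ?_)
    · refine setLIntegral_congr_fun measurableSet_Ioi fun y hy => ?_
      have hz' : (0 : ℝ) < z := hz
      have hy' : (0 : ℝ) < y := hy
      simp only [quadKer]
      rw [← ENNReal.ofReal_mul (by positivity)]
      congr 1
      have hD : 0 < y + z + m := by positivity
      rw [show 2 * y + m + (2 * z + m) = 2 * (y + z + m) by ring]
      rw [show ((2 * y + m) * (2 * z + m) + m ^ 2) / (2 * (y + z + m)) =
        2 * (y * z / (y + z + m)) + m by field_simp; ring]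
      ring
    · congr 1
      refine setLIntegral_congr_fun measurableSet_Ioi fun σ hσ => ?_
      have hσ' : (0 : ℝ) < σ := hσ
      simp only [besselKer]
      rw [← ENNReal.ofReal_mul (by positivity), mul_assoc, ← exp_add, abs_of_nonneg hm]
      congr 3
      ring
  · exact (besselKer_integrableOn hb2 hρX m)
  · exact (ae_restrict_iff' measurableSet_Ioi).2 (ae_of_all _ fun y hy => besselKer_nonneg hy)

lemma measurable_quadKer_mul_gaussPair {n : ℕ} (b b' ρ m : ℝ)
    (w : EuclideanSpace ℝ (Fin n) × EuclideanSpace ℝ (Fin n)) :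
    Measurable fun p : (ℝ × ℝ) × (EuclideanSpace ℝ (Fin n) × EuclideanSpace ℝ (Fin n)) =>
      quadKer b b' ρ m p.1 * gaussPair (2 * p.1.2 + m) (2 * p.1.1 + m) w p.2 := by
  have := measurable_quadKer b b' ρ m
  unfold gaussPair
  fun_prop

lemma integrable_quadKer_mul {n : ℕ} {s b b' ρ m : ℝ} (hs : 0 < s) (hρ : 0 < ρ) (hm : 0 ≤ m)
    (hb : b = (n + 1 - s) / 2) (hb' : b' = (n + 1 + s) / 2) (hb2 : 1 / 2 < b) {X : ℝ}
    (hX : 0 ≤ X) :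
    Integrable (fun z => quadKer b b' ρ m z * ((π / (2 * z.2 + m + (2 * z.1 + m))) ^ n *
      exp (-(X * (((2 * z.2 + m) * (2 * z.1 + m) + m ^ 2) / (2 * z.2 + m + (2 * z.1 + m)))))))
        quadMeasure := by
  have := measurable_quadKer b b' ρ m
  refine ⟨by fun_prop, (hasFiniteIntegral_iff_ofReal ?_).2 ?_⟩
  · filter_upwards [ae_quadMeasure] with z hz
    have := quadKer_nonneg (b := b) (b' := b') (ρ := ρ) hm hz.1 hz.2
    have h1 := hz.1
    have h2 := hz.2
    simp only [Pi.zero_apply]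
    positivity
  · rw [lintegral_quadKer hs hρ hm hb hb' hb2 hX]
    exact ENNReal.ofReal_lt_top

lemma integral_quadKer_mul {n : ℕ} {s b b' ρ m : ℝ} (hs : 0 < s) (hρ : 0 < ρ) (hm : 0 ≤ m)
    (hb : b = (n + 1 - s) / 2) (hb' : b' = (n + 1 + s) / 2) (hb2 : 1 / 2 < b) {X : ℝ}
    (hX : 0 ≤ X) :
    ∫ z, quadKer b b' ρ m z * ((π / (2 * z.2 + m + (2 * z.1 + m))) ^ n *
      exp (-(X * (((2 * z.2 + m) * (2 * z.1 + m) + m ^ 2) / (2 * z.2 + m + (2 * z.1 + m))))))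
        ∂quadMeasure =
      (π / 2) ^ n * (Gamma s * (2 * ρ ^ 2) ^ (-s)) * besselG b (ρ ^ 2 + X) m := by
  have hΓ := Gamma_pos_of_pos hs
  have hG := besselG_nonneg b (ρ ^ 2 + X) m
  rw [integral_eq_lintegral_of_nonneg_ae,  lintegral_quadKer hs hρ hm hb hb' hb2 hX,
    ENNReal.toReal_ofReal (by positivity)]
  · filter_upwards [ae_quadMeasure] with z hz
    have := quadKer_nonneg (b := b) (b' := b') (ρ := ρ) hm hz.1 hz.2
    have h1 := hz.1
    have h2 := hz.2
    simp only [Pi.zero_apply]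
    positivity
  · exact (integrable_quadKer_mul hs hρ hm hb hb' hb2 hX).1

lemma integrable_quadKer_mul_gaussPair {n : ℕ} {s b b' ρ m : ℝ} (hs : 0 < s) (hρ : 0 < ρ)
    (hm : 0 ≤ m) (hb : b = (n + 1 - s) / 2) (hb' : b' = (n + 1 + s) / 2) (hb2 : 1 / 2 < b)
    (w : EuclideanSpace ℝ (Fin n) × EuclideanSpace ℝ (Fin n)) :
    Integrable (fun p : (ℝ × ℝ) × (EuclideanSpace ℝ (Fin n) × EuclideanSpace ℝ (Fin n)) =>
      quadKer b b' ρ m p.1 * gaussPair (2 * p.1.2 + m) (2 * p.1.1 + m) w p.2)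
      (quadMeasure.prod volume) := by
  have hmeas := (measurable_quadKer_mul_gaussPair b b' ρ m w).aestronglyMeasurable
    (μ := quadMeasure.prod volume)
  refine (integrable_prod_iff hmeas).2 ⟨?_, ?_⟩
  · filter_upwards [ae_quadMeasure] with z hz
    exact (integrable_gaussPair (by linarith [hz.1, hz.2]) w).const_mul _
  · have h0 := integrable_quadKer_mul hs hρ hm hb hb' hb2 le_rfl
    refine h0.mono' hmeas.norm.integral_prod_right' ?_
    filter_upwards [ae_quadMeasure] with z hz
    have h1 := quadKer_nonneg (b := b) (b' := b') (ρ := ρ) hm hz.1 hz.2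
    have h2 := hz.1
    have h3 := hz.2
    have h4 : 0 < 2 * z.2 + m + (2 * z.1 + m) := by positivity
    simp only [norm_mul, norm_of_nonneg h1, norm_of_nonneg (gaussPair_pos _ _ _ _).le]
    rw [integral_const_mul, integral_gaussPair h4, norm_of_nonneg (by positivity)]
    refine mul_le_mul_of_nonneg_left ?_ h1
    refine mul_le_mul_of_nonneg_left ?_ (by positivity)
    rw [zero_mul]
    refine exp_le_exp.2 (neg_le_neg ?_)
    positivity

lemma integrable_besselG_mul_besselG {n : ℕ} {s b b' ρ : ℝ} (hs : 0 < s) (hρ : 0 < ρ)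
    (hb : b = (n + 1 - s) / 2) (hb' : b' = (n + 1 + s) / 2) (hb2 : 1 / 2 < b)
    (w : EuclideanSpace ℝ (Fin n) × EuclideanSpace ℝ (Fin n)) (u : ℝ) :
    Integrable fun v => besselG b (nsq v) u * besselG b' (ρ ^ 2 + nsq (w - v)) u := by
  simp_rw [besselG_mul_besselG]
  exact (integrable_quadKer_mul_gaussPair hs hρ (abs_nonneg u) hb hb' hb2 w).integral_prod_right

lemma besselG_abs (b A u : ℝ) : besselG b A |u| = besselG b A u := by
  simp [besselG, besselKer]

lemma integral_cexp_mul_besselG_mul_besselG {n : ℕ} {s b b' ρ : ℝ} (hs : 0 < s) (hρ : 0 < ρ)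
    (hb : b = (n + 1 - s) / 2) (hb' : b' = (n + 1 + s) / 2) (hb2 : 1 / 2 < b)
    (w : EuclideanSpace ℝ (Fin n) × EuclideanSpace ℝ (Fin n)) (u : ℝ) :
    ∫ v, Complex.exp (-(2 * u * sympl v w) * Complex.I) *
        ((besselG b (nsq v) u * besselG b' (ρ ^ 2 + nsq (w - v)) u : ℝ) : ℂ) =
      (((π / 2) ^ n * (Gamma s * (2 * ρ ^ 2) ^ (-s)) * besselG b (ρ ^ 2 + nsq w) u : ℝ) : ℂ) := by
  have h_int := integrable_quadKer_mul_gaussPair hs hρ (abs_nonneg u) hb hb' hb2 w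
  set F : (ℝ × ℝ) → (EuclideanSpace ℝ (Fin n) × EuclideanSpace ℝ (Fin n)) → ℂ := fun z v =>
    Complex.exp (-(2 * u * sympl v w) * Complex.I) *
      ((quadKer b b' ρ |u| z * gaussPair (2 * z.2 + |u|) (2 * z.1 + |u|) w v : ℝ) : ℂ) with hF
  have hFi : Integrable (Function.uncurry F) (quadMeasure.prod volume) := by
    refine h_int.ofReal.bdd_mul (c := 1)
      (f := fun p : (ℝ × ℝ) × (EuclideanSpace ℝ (Fin n) × EuclideanSpace ℝ (Fin n)) =>
        Complex.exp (-(2 * u * sympl p.2 w) * Complex.I)) ?_ ?_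
    · have := (continuous_sympl w).comp
        (continuous_snd (X := ℝ × ℝ) (Y := EuclideanSpace ℝ (Fin n) × EuclideanSpace ℝ (Fin n)))
      simp only [Function.comp_def] at this
      exact (by fun_prop : Continuous fun p : (ℝ × ℝ) × (EuclideanSpace ℝ (Fin n) ×
        EuclideanSpace ℝ (Fin n)) => Complex.exp (-(2 * u * sympl p.2 w) * Complex.I)
        ).aestronglyMeasurable
    · refine ae_of_all _ fun z => le_of_eq ?_
      have := Complex.norm_exp_ofReal_mul_I (-(2 * u * sympl z.2 w))
      push_cast at this
      exact this
  have h1 : ∀ v, Complex.exp (-(2 * u * sympl v w) * Complex.I) *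
      ((besselG b (nsq v) u * besselG b' (ρ ^ 2 + nsq (w - v)) u : ℝ) : ℂ) =
      ∫ z, F z v ∂quadMeasure := by
    intro v
    rw [besselG_mul_besselG, integral_const_mul, integral_complex_ofReal]
  simp_rw [h1]
  rw [← integral_integral_swap hFi, ← besselG_abs b _ u,
    ← integral_quadKer_mul hs hρ (abs_nonneg u) hb hb' hb2 (nsq_nonneg w),
    ← integral_complex_ofReal]
  refine integral_congr_ae ?_
  filter_upwards [ae_quadMeasure] with z hz
  have h2 := hz.1
  have h3 := hz.2
  have h4 := integral_cexp_mul_gaussPair (n := n) (α := 2 * z.2 + |u|) (β := 2 * z.1 + |u|)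
    (by positivity) u w
  rw [sq_abs, Complex.ofReal_mul, nsq, ← h4, ← integral_const_mul]
  refine integral_congr_ae (ae_of_all _ fun v => ?_)
  simp only [hF]
  push_cast
  ring

lemma integral_besselG_mul_besselG_le {n : ℕ} {s b b' ρ : ℝ} (hs : 0 < s) (hρ : 0 < ρ)
    (hb : b = (n + 1 - s) / 2) (hb' : b' = (n + 1 + s) / 2) (hb2 : 1 / 2 < b)
    (w : EuclideanSpace ℝ (Fin n) × EuclideanSpace ℝ (Fin n)) (u : ℝ) :
    ∫ v, besselG b (nsq v) u * besselG b' (ρ ^ 2 + nsq (w - v)) u ≤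
      (π / 2) ^ n * (Gamma s * (2 * ρ ^ 2) ^ (-s)) * besselG b (ρ ^ 2) u := by
  have h_int := integrable_quadKer_mul_gaussPair hs hρ (abs_nonneg u) hb hb' hb2 w
  have h0 := integrable_quadKer_mul hs hρ (abs_nonneg u) hb hb' hb2 le_rfl
  have h00 := integral_quadKer_mul hs hρ (abs_nonneg u) hb hb' hb2 le_rfl
  rw [add_zero, besselG_abs] at h00
  simp_rw [besselG_mul_besselG]
  rw [← integral_integral_swap (f := fun (z : ℝ × ℝ)
    (v : EuclideanSpace ℝ (Fin n) × EuclideanSpace ℝ (Fin n)) =>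
    quadKer b b' ρ |u| z * gaussPair (2 * z.2 + |u|) (2 * z.1 + |u|) w v) h_int, ← h00]
  refine integral_mono_ae h_int.integral_prod_left h0 ?_
  filter_upwards [ae_quadMeasure] with z hz
  have h1 := quadKer_nonneg (b := b) (b' := b') (ρ := ρ) (abs_nonneg u) hz.1 hz.2
  have h2 := hz.1
  have h3 := hz.2
  have h4 : 0 < 2 * z.2 + |u| + (2 * z.1 + |u|) := by positivity
  rw [integral_const_mul, integral_gaussPair h4]
  refine mul_le_mul_of_nonneg_left ?_ h1
  refine mul_le_mul_of_nonneg_left ?_ (by positivity)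
  rw [zero_mul]
  refine exp_le_exp.2 (neg_le_neg ?_)
  positivity

lemma integrable_besselG_mul_besselG_prod {n : ℕ} {s b b' ρ : ℝ} (hs : 0 < s) (hρ : 0 < ρ)
    (hb : b = (n + 1 - s) / 2) (hb' : b' = (n + 1 + s) / 2) (hb2 : 1 / 2 < b)
    (w : EuclideanSpace ℝ (Fin n) × EuclideanSpace ℝ (Fin n)) :
    Integrable (fun p : ℝ × (EuclideanSpace ℝ (Fin n) × EuclideanSpace ℝ (Fin n)) =>
      besselG b (nsq p.2) p.1 * besselG b' (ρ ^ 2 + nsq (w - p.2)) p.1)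
      (volume.prod volume) := by
  have hn := (continuous_nsq (n := n)).measurable
  have hmeas : AEStronglyMeasurable
      (fun p : ℝ × (EuclideanSpace ℝ (Fin n) × EuclideanSpace ℝ (Fin n)) =>
        besselG b (nsq p.2) p.1 * besselG b' (ρ ^ 2 + nsq (w - p.2)) p.1)
      (volume.prod volume) := by
    refine Measurable.aestronglyMeasurable (Measurable.mul ?_ ?_)
    · exact (measurable_besselG b).comp ((hn.comp measurable_snd).prodMk measurable_fst)
    · refine (measurable_besselG b').comp (Measurable.prodMk ?_ measurable_fst)
      exact measurable_const.add (hn.comp (measurable_const.sub measurable_snd))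
  refine (integrable_prod_iff hmeas).2 ⟨ae_of_all _ fun u =>
    integrable_besselG_mul_besselG hs hρ hb hb' hb2 w u, ?_⟩
  have h1 : Integrable (fun u => (π / 2) ^ n * (Gamma s * (2 * ρ ^ 2) ^ (-s)) *
      besselG b (ρ ^ 2) u) := (integrable_besselG (by linarith) (by positivity)).const_mul _
  refine h1.mono' hmeas.norm.integral_prod_right' (ae_of_all _ fun u => ?_)
  have h2 : ∀ v, 0 ≤ besselG b (nsq v) u * besselG b' (ρ ^ 2 + nsq (w - v)) u := fun v =>
    mul_nonneg (besselG_nonneg _ _ _) (besselG_nonneg _ _ _)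
  simp only
  rw [norm_of_nonneg (integral_nonneg fun v => norm_nonneg _)]
  simp_rw [norm_of_nonneg (h2 _)]
  exact integral_besselG_mul_besselG_le hs hρ hb hb' hb2 w u

/-- The total mass of `phiK n s ρ`. -/
def massK (n : ℕ) (s ρ : ℝ) : ℝ :=
  π / 2 * (Gamma ((n + 1 + s) / 2))⁻¹ ^ 2 * ((π / 2) ^ n * (Gamma s * (2 * ρ ^ 2) ^ (-s)))

lemma massK_pos {n : ℕ} {s ρ : ℝ} (hs : 0 < s) (hρ : 0 < ρ) : 0 < massK n s ρ := by
  have h1 := Gamma_pos_of_pos hs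
  have h2 : 0 < Gamma ((n + 1 + s) / 2) := Gamma_pos_of_pos (by positivity)
  unfold massK; positivity

lemma nsq_pos {n : ℕ} {v : EuclideanSpace ℝ (Fin n) × EuclideanSpace ℝ (Fin n)} (hv : v ≠ 0) :
    0 < nsq v := by
  unfold nsq
  by_contra h
  have h1 : ‖v.1‖ = 0 := by nlinarith [sq_nonneg ‖v.1‖, sq_nonneg ‖v.2‖]
  have h2 : ‖v.2‖ = 0 := by nlinarith [sq_nonneg ‖v.1‖, sq_nonneg ‖v.2‖]
  exact hv (Prod.ext (norm_eq_zero.1 h1) (norm_eq_zero.1 h2))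

lemma ae_nsq_pos {n : ℕ} (hn : 1 ≤ n) :
    ∀ᵐ v : EuclideanSpace ℝ (Fin n) × EuclideanSpace ℝ (Fin n), 0 < nsq v := by
  have : Nonempty (Fin n) := ⟨⟨0, hn⟩⟩
  have : Nontrivial (EuclideanSpace ℝ (Fin n)) := inferInstance
  have : NullSingletonClass (volume : Measure (EuclideanSpace ℝ (Fin n) × EuclideanSpace ℝ (Fin n))) :=
    Measure.prod.instNullSingletonClass_fst
  have : ∀ᵐ v : EuclideanSpace ℝ (Fin n) × EuclideanSpace ℝ (Fin n), v ≠ 0 :=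
    compl_mem_ae_iff.2 (measure_singleton 0)
  filter_upwards [this] with v hv using nsq_pos hv

/-- The vertical convolution of two profiles, as a function of the horizontal variable. -/
def profileConv {n : ℕ} (b b' ρ t : ℝ)
    (w v : EuclideanSpace ℝ (Fin n) × EuclideanSpace ℝ (Fin n)) : ℝ :=
  ∫ t' : ℝ, profile b (nsq v) t' * profile b' (ρ ^ 2 + nsq (w - v)) (t + 1 / 2 * sympl v w - t')

lemma profileConv_ae_eq {n : ℕ} (hn : 1 ≤ n) {b b' ρ : ℝ} (hρ : 0 < ρ) (hb2 : 1 / 2 < b)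
    (hb2' : 1 / 2 < b') (t : ℝ) (w : EuclideanSpace ℝ (Fin n) × EuclideanSpace ℝ (Fin n)) :
    (fun v => ((profileConv b b' ρ t w v : ℝ) : ℂ)) =ᵐ[volume] fun v =>
      ((π / 2 * (Gamma b)⁻¹ ^ 2 * (Gamma b')⁻¹ ^ 2 : ℝ) : ℂ) *
        ∫ u : ℝ, Complex.exp (-(4 * t * u) * Complex.I) *
          (Complex.exp (-(2 * u * sympl v w) * Complex.I) *
          ((besselG b (nsq v) u * besselG b' (ρ ^ 2 + nsq (w - v)) u : ℝ) : ℂ)) := by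
  filter_upwards [ae_nsq_pos hn] with v hv
  unfold profileConv
  have := nsq_nonneg (w - v)
  rw [integral_profile_mul_profile hb2 hb2' hv (by positivity)]
  congr 1
  refine integral_congr_ae (ae_of_all _ fun u => ?_)
  simp only
  rw [← mul_assoc, ← Complex.exp_add]
  congr 2
  push_cast
  ring

lemma integrable_phase {n : ℕ} {s b b' ρ : ℝ} (hs : 0 < s) (hρ : 0 < ρ)
    (hb : b = (n + 1 - s) / 2) (hb' : b' = (n + 1 + s) / 2) (hb2 : 1 / 2 < b) (t : ℝ)
    (w : EuclideanSpace ℝ (Fin n) × EuclideanSpace ℝ (Fin n)) :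
    Integrable (fun p : ℝ × (EuclideanSpace ℝ (Fin n) × EuclideanSpace ℝ (Fin n)) =>
      Complex.exp (-(4 * t * p.1) * Complex.I) *
          (Complex.exp (-(2 * p.1 * sympl p.2 w) * Complex.I) *
          ((besselG b (nsq p.2) p.1 * besselG b' (ρ ^ 2 + nsq (w - p.2)) p.1 : ℝ) : ℂ)))
      (volume.prod volume) := by
  have h_int := integrable_besselG_mul_besselG_prod hs hρ hb hb' hb2 w
  have hc := (continuous_sympl w).comp
    (continuous_snd (X := ℝ) (Y := EuclideanSpace ℝ (Fin n) × EuclideanSpace ℝ (Fin n)))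
  simp only [Function.comp_def] at hc
  simp_rw [← mul_assoc, ← Complex.exp_add]
  refine h_int.ofReal.bdd_mul (c := 1)
      (f := fun p : ℝ × (EuclideanSpace ℝ (Fin n) × EuclideanSpace ℝ (Fin n)) =>
        Complex.exp (-(4 * t * p.1) * Complex.I + -(2 * p.1 * sympl p.2 w) * Complex.I)) ?_ ?_
  · exact (by fun_prop : Continuous fun p : ℝ × (EuclideanSpace ℝ (Fin n) ×
        EuclideanSpace ℝ (Fin n)) => Complex.exp (-(4 * t * p.1) * Complex.I +
          -(2 * p.1 * sympl p.2 w) * Complex.I)).aestronglyMeasurable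
  · refine ae_of_all _ fun z => le_of_eq ?_
    have := Complex.norm_exp_ofReal_mul_I (-(4 * t * z.1) + -(2 * z.1 * sympl z.2 w))
    push_cast at this
    rwa [add_mul] at this

lemma integrable_profileConv {n : ℕ} (hn : 1 ≤ n) {s b b' ρ : ℝ} (hs : 0 < s) (hρ : 0 < ρ)
    (hb : b = (n + 1 - s) / 2) (hb' : b' = (n + 1 + s) / 2) (hb2 : 1 / 2 < b) (t : ℝ)
    (w : EuclideanSpace ℝ (Fin n) × EuclideanSpace ℝ (Fin n)) :
    Integrable (profileConv b b' ρ t w) := by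
  have h1 := (integrable_phase hs hρ hb hb' hb2 t w).integral_prod_right
  have h2 := (h1.const_mul ((π / 2 * (Gamma b)⁻¹ ^ 2 * (Gamma b')⁻¹ ^ 2 : ℝ) : ℂ)).congr
    (profileConv_ae_eq hn hρ hb2 (by linarith) t w).symm
  exact h2.re

lemma integral_profileConv {n : ℕ} (hn : 1 ≤ n) {s b b' ρ : ℝ} (hs : 0 < s) (hρ : 0 < ρ)
    (hb : b = (n + 1 - s) / 2) (hb' : b' = (n + 1 + s) / 2) (hb2 : 1 / 2 < b) (t : ℝ)
    (w : EuclideanSpace ℝ (Fin n) × EuclideanSpace ℝ (Fin n)) :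
    ∫ v, profileConv b b' ρ t w v = massK n s ρ * profile b (ρ ^ 2 + nsq w) t := by
  have hb0 : 0 < b := by linarith
  have hG : (Gamma b : ℂ) ≠ 0 := by exact_mod_cast (Gamma_pos_of_pos hb0).ne'
  have hw := nsq_nonneg w
  apply Complex.ofReal_injective
  rw [← integral_complex_ofReal, integral_congr_ae (profileConv_ae_eq hn hρ hb2 (by linarith) t w),
    integral_const_mul, ← integral_integral_swap (integrable_phase hs hρ hb hb' hb2 t w)]
  simp_rw [integral_const_mul, integral_cexp_mul_besselG_mul_besselG hs hρ hb hb' hb2]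
  have h := integral_exp_mul_besselG hb0 (A := ρ ^ 2 + nsq w) (by positivity) t
  have h2 : ∀ u : ℝ, Complex.exp (-(4 * t * u) * Complex.I) *
      (((π / 2) ^ n * (Gamma s * (2 * ρ ^ 2) ^ (-s)) * besselG b (ρ ^ 2 + nsq w) u : ℝ) : ℂ) =
      (((π / 2) ^ n * (Gamma s * (2 * ρ ^ 2) ^ (-s)) : ℝ) : ℂ) *
        (Complex.exp (-(4 * t * u) * Complex.I) * besselG b (ρ ^ 2 + nsq w) u) := by
    intro u
    push_cast
    ring
  simp_rw [h2]
  rw [integral_const_mul, h, massK, ← hb']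
  push_cast
  field_simp

lemma lintegral_heis {n : ℕ} {F : Heis n → ℝ≥0∞} (hF : Measurable F) :
    ∫⁻ h, F h = ∫⁻ v : EuclideanSpace ℝ (Fin n) × EuclideanSpace ℝ (Fin n), ∫⁻ t : ℝ,
      F (v.1, v.2, t) := by
  have h1 := (MeasureTheory.volume_preserving_prodAssoc (α₁ := EuclideanSpace ℝ (Fin n))
    (β₁ := EuclideanSpace ℝ (Fin n)) (γ₁ := ℝ)).lintegral_comp hF
  rw [← h1, Measure.volume_eq_prod, lintegral_prod]
  · rfl
  · exact (hF.comp MeasurableEquiv.prodAssoc.measurable).aemeasurable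

lemma phiK_eq_profile (n : ℕ) (s ρ : ℝ)
    (v : EuclideanSpace ℝ (Fin n) × EuclideanSpace ℝ (Fin n)) (t : ℝ) :
    phiK n s ρ (v.1, v.2, t) = profile ((n + 1 + s) / 2) (ρ ^ 2 + nsq v) t := rfl

lemma phiK_nonneg (n : ℕ) (s ρ : ℝ) (p : Heis n) : 0 ≤ phiK n s ρ p := by
  unfold phiK; positivity

lemma measurable_phiK (n : ℕ) (s ρ : ℝ) : Measurable (phiK n s ρ) := by
  unfold phiK; fun_prop

lemma continuous_hmul {n : ℕ} : Continuous fun z : Heis n × Heis n => hmul z.1 z.2 := by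
  unfold hmul; fun_prop

lemma continuous_hinv {n : ℕ} : Continuous (hinv (n := n)) := by
  unfold hinv; fun_prop

lemma measurable_hmul_hinv_left {n : ℕ} (p : Heis n) :
    Measurable fun h : Heis n => hmul (hinv h) p :=
  (continuous_hmul.comp (continuous_hinv.prodMk continuous_const)).measurable

lemma lintegral_phiK_mul_phiK {n : ℕ} (hn : 1 ≤ n) {s ρ : ℝ} (hs : 0 < s) (hs1 : s < 1)
    (hρ : 0 < ρ) (p : Heis n) :
    ∫⁻ h, ENNReal.ofReal (phiK n (-s) 0 h * phiK n s ρ (hmul (hinv h) p)) =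
      ENNReal.ofReal (massK n s ρ * phiK n (-s) ρ p) := by
  have hn' : (1 : ℝ) ≤ n := by exact_mod_cast hn
  obtain ⟨a, c, t⟩ := p
  set w : EuclideanSpace ℝ (Fin n) × EuclideanSpace ℝ (Fin n) := (a, c) with hw
  set b : ℝ := (n + 1 + -s) / 2 with hbdef
  set b' : ℝ := (n + 1 + s) / 2 with hb'
  have hb : b = (n + 1 - s) / 2 := by rw [hbdef]; ring
  have hb2 : 1 / 2 < b := by rw [hb]; linarith
  have hb2' : 1 / 2 < b' := by linarith
  rw [lintegral_heis]
  swap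
  · exact ((measurable_phiK _ _ _).mul
      ((measurable_phiK _ _ _).comp (measurable_hmul_hinv_left _))).ennreal_ofReal
  have h1 : ∀ᵐ v : EuclideanSpace ℝ (Fin n) × EuclideanSpace ℝ (Fin n),
      ∫⁻ t' : ℝ, ENNReal.ofReal (phiK n (-s) 0 (v.1, v.2, t') *
        phiK n s ρ (hmul (hinv (v.1, v.2, t')) (a, c, t))) =
      ENNReal.ofReal (profileConv b b' ρ t w v) := by
    filter_upwards [ae_nsq_pos hn] with v hv
    have h0 := nsq_nonneg (w - v)
    rw [profileConv, ofReal_integral_eq_lintegral_ofReal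
      (integrable_profile_mul_profile hb2 hb2' hv (by positivity) _)
      (ae_of_all _ fun _ => mul_nonneg (profile_nonneg _ _ _) (profile_nonneg _ _ _))]
    refine lintegral_congr fun t' => ?_
    congr 2
    · rw [phiK_eq_profile, ← hbdef]
      simp
    · have : hmul (hinv (v.1, v.2, t')) (a, c, t) =
          ((w - v).1, (w - v).2, t + 1 / 2 * sympl v w - t') := by
        simp only [hmul, hinv, sympl, hw, Prod.mk.injEq, Prod.fst_sub, Prod.snd_sub]
        refine ⟨neg_add_eq_sub _ _, neg_add_eq_sub _ _, ?_⟩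
        have : ∑ j, ((-v.2) j * a j - (-v.1) j * c j) = ∑ j, (v.1 j * c j - v.2 j * a j) :=
          Finset.sum_congr rfl fun j _ => by simp only [PiLp.neg_apply]; ring
        rw [this]
        ring
      rw [this, phiK_eq_profile]
  rw [lintegral_congr_ae h1, ← ofReal_integral_eq_lintegral_ofReal
    (integrable_profileConv hn hs hρ hb hb' hb2 t w) (ae_of_all _ fun v => ?_),
    integral_profileConv hn hs hρ hb hb' hb2 t w]
  · rfl
  · exact integral_nonneg fun _ => mul_nonneg (profile_nonneg _ _ _) (profile_nonneg _ _ _)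

lemma measurable_nsq {n : ℕ} : Measurable (nsq (n := n)) := continuous_nsq.measurable

lemma lintegral_exp_nsq {n : ℕ} {y : ℝ} (hy : 0 < y) :
    ∫⁻ v : EuclideanSpace ℝ (Fin n) × EuclideanSpace ℝ (Fin n),
      ENNReal.ofReal (exp (-(2 * nsq v * y))) = ENNReal.ofReal ((π / 2) ^ n * y ^ (-(n : ℝ))) := by
  have h := lintegral_exp_neg_mul_norm_sq (n := n) (r := 2 * y) (by positivity)
  rw [← div_div, div_pow, div_eq_mul_inv, ← rpow_natCast y, ← rpow_neg hy.le] at h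
  rw [← h]
  refine lintegral_congr fun v => ?_
  congr 3
  unfold nsq
  ring

lemma lintegral_phiK {n : ℕ} (hn : 1 ≤ n) {s ρ : ℝ} (hs : 0 < s) (hρ : 0 < ρ) :
    ∫⁻ h, ENNReal.ofReal (phiK n s ρ h) = ENNReal.ofReal (massK n s ρ) := by
  have hn' : (1 : ℝ) ≤ n := by exact_mod_cast hn
  set b' : ℝ := (n + 1 + s) / 2 with hb'
  have hb2' : 1 / 2 < b' := by rw [hb']; linarith
  rw [lintegral_heis (measurable_phiK _ _ _).ennreal_ofReal]
  have hA : ∀ v : EuclideanSpace ℝ (Fin n) × EuclideanSpace ℝ (Fin n), 0 < ρ ^ 2 + nsq v :=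
    fun v => by have := nsq_nonneg v; positivity
  simp_rw [phiK_eq_profile, ← hb', lintegral_profile hb2' (hA _)]
  have hm := measurable_nsq (n := n)
  rw [lintegral_const_mul, lintegral_lintegral_swap]
  rotate_left
  · exact Measurable.aemeasurable (by fun_prop)
  · refine Measurable.lintegral_prod_right ?_
    fun_prop
  rw [massK, ← hb', ENNReal.ofReal_mul (p := π / 2 * (Gamma b')⁻¹ ^ 2) (by positivity)]
  congr 1
  rw [ENNReal.ofReal_mul (p := (π / 2) ^ n) (by positivity),
    ← lintegral_rpow_mul_exp hs (by positivity), ← lintegral_const_mul _ (by fun_prop)]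
  refine setLIntegral_congr_fun measurableSet_Ioi fun y hy => ?_
  have hy' : (0 : ℝ) < y := hy
  have h1 : ∀ v : EuclideanSpace ℝ (Fin n) × EuclideanSpace ℝ (Fin n),
      ENNReal.ofReal (y ^ (2 * b' - 2) * exp (-(2 * (ρ ^ 2 + nsq v) * y))) =
      ENNReal.ofReal (y ^ (2 * b' - 2) * exp (-(2 * ρ ^ 2 * y))) *
        ENNReal.ofReal (exp (-(2 * nsq v * y))) := by
    intro v
    rw [← ENNReal.ofReal_mul (by positivity), mul_assoc (y ^ (2 * b' - 2)), ← exp_add]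
    congr 3
    ring
  simp_rw [h1]
  rw [lintegral_const_mul _ (by fun_prop), lintegral_exp_nsq hy', ← ENNReal.ofReal_mul
    (by positivity), ← ENNReal.ofReal_mul (by positivity)]
  congr 1
  have h2 : y ^ (2 * b' - 2) * y ^ (-(n : ℝ)) = y ^ (s - 1) := by
    rw [← rpow_add hy']
    congr 1
    rw [hb']
    ring
  rw [← h2]
  ring

/-- The difference between the singular kernel and its regularisation at scale `ρ`. -/
def etaK (n : ℕ) (s ρ : ℝ) (p : Heis n) : ℝ := phiK n (-s) 0 p - phiK n (-s) ρ p

/-- The total mass of `etaK n s 1`. -/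
def etaMass (n : ℕ) (s : ℝ) : ℝ :=
  π / 2 * (Gamma ((n + 1 + -s) / 2))⁻¹ ^ 2 * ((π / 2) ^ n * (Gamma (1 - s) * (2 ^ s / s)))

lemma lintegral_rpow_mul_one_sub_exp {s : ℝ} (hs : 0 < s) (hs1 : s < 1) :
    ∫⁻ y in Ioi 0, ENNReal.ofReal (y ^ (-s - 1) * (1 - exp (-(2 * y)))) =
      ENNReal.ofReal (Gamma (1 - s) * (2 ^ s / s)) := by
  have h1 : ∀ y ∈ Ioi (0 : ℝ), ENNReal.ofReal (y ^ (-s - 1) * (1 - exp (-(2 * y)))) =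
      ∫⁻ x in Ioc 0 2, ENNReal.ofReal (y ^ (1 - s - 1) * exp (-(x * y))) := by
    intro y hy
    have hy' : (0 : ℝ) < y := hy
    have hc : Continuous fun x : ℝ => y ^ (1 - s - 1) * exp (-(x * y)) := by fun_prop
    rw [← ofReal_integral_eq_lintegral_ofReal (hc.integrableOn_Ioc)
      (ae_of_all _ fun x => by positivity), ← intervalIntegral.integral_of_le (by norm_num)]
    congr 1
    have hd : ∀ x ∈ uIcc (0 : ℝ) 2, HasDerivAt (fun x => -(y ^ (-s - 1) * exp (-(x * y))))
        (y ^ (1 - s - 1) * exp (-(x * y))) x := by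
      intro x _
      have h := (((hasDerivAt_id x).mul_const y).neg.exp.const_mul (y ^ (-s - 1))).neg
      refine h.congr_deriv ?_
      have : y ^ (1 - s - 1) = y ^ (-s - 1) * y := by
        rw [← rpow_add_one hy'.ne']; congr 1; ring
      rw [this]
      simp only [id, Pi.neg_apply]
      ring
    rw [intervalIntegral.integral_eq_sub_of_hasDerivAt hd (hc.intervalIntegrable _ _)]
    simp only [zero_mul, neg_zero, exp_zero]
    ring
  rw [setLIntegral_congr_fun measurableSet_Ioi h1, lintegral_lintegral_swap
    (Measurable.aemeasurable (by fun_prop))]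
  have h2 : ∀ x ∈ Ioc (0 : ℝ) 2,
      ∫⁻ y in Ioi 0, ENNReal.ofReal (y ^ (1 - s - 1) * exp (-(x * y))) =
      ENNReal.ofReal (Gamma (1 - s) * x ^ (-(1 - s))) := fun x hx =>
    lintegral_rpow_mul_exp (by linarith) hx.1
  rw [setLIntegral_congr_fun measurableSet_Ioc h2]
  have hΓ := Gamma_pos_of_pos (by linarith : 0 < 1 - s)
  have hi : IntegrableOn (fun x : ℝ => x ^ (-(1 - s))) (Ioc 0 2) := by
    have := intervalIntegral.intervalIntegrable_rpow' (a := 0) (b := 2) (r := -(1 - s))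
      (by linarith)
    rwa [intervalIntegrable_iff_integrableOn_Ioc_of_le (by norm_num)] at this
  rw [← ofReal_integral_eq_lintegral_ofReal (hi.const_mul _)
    ((ae_restrict_iff' measurableSet_Ioc).2 (ae_of_all _ fun x hx => by
      have := hx.1
      simp only [Pi.zero_apply]
      positivity)), integral_const_mul, ← intervalIntegral.integral_of_le (by norm_num),
    integral_rpow (Or.inl (by linarith))]
  congr 2
  rw [show -(1 - s) + 1 = s by ring, zero_rpow hs.ne', sub_zero]

lemma etaK_nonneg {n : ℕ} {s : ℝ} (hs1 : s < n + 1) (ρ : ℝ) {p : Heis n}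
    (hp : 0 < ‖p.1‖ ^ 2 + ‖p.2.1‖ ^ 2) : 0 ≤ etaK n s ρ p := by
  refine sub_nonneg.2 (profile_anti (b := (n + 1 + -s) / 2) (by linarith) ?_ ?_ p.2.2)
  · positivity
  · nlinarith

lemma measurable_etaK (n : ℕ) (s ρ : ℝ) : Measurable (etaK n s ρ) :=
  (measurable_phiK _ _ _).sub (measurable_phiK _ _ _)

lemma lintegral_etaK {n : ℕ} (hn : 1 ≤ n) {s : ℝ} (hs : 0 < s) (hs1 : s < 1) :
    ∫⁻ h, ENNReal.ofReal (etaK n s 1 h) = ENNReal.ofReal (etaMass n s) := by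
  have hn' : (1 : ℝ) ≤ n := by exact_mod_cast hn
  set b : ℝ := (n + 1 + -s) / 2 with hb
  have hb2 : 1 / 2 < b := by rw [hb]; linarith
  have hm := measurable_nsq (n := n)
  rw [lintegral_heis (measurable_etaK _ _ _).ennreal_ofReal]
  have h1 : ∀ᵐ v : EuclideanSpace ℝ (Fin n) × EuclideanSpace ℝ (Fin n),
      ∫⁻ t : ℝ, ENNReal.ofReal (etaK n s 1 (v.1, v.2, t)) =
      ENNReal.ofReal (π / 2 * (Gamma b)⁻¹ ^ 2) *
      ∫⁻ y in Ioi 0, ENNReal.ofReal (y ^ (2 * b - 2) *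
        (exp (-(2 * nsq v * y)) - exp (-(2 * (1 + nsq v) * y)))) := by
    filter_upwards [ae_nsq_pos hn] with v hv
    rw [← lintegral_profile_sub hb2 hv (by linarith)]
    refine lintegral_congr fun t => ?_
    simp only [etaK, phiK_eq_profile, ← hb]
    simp
  rw [lintegral_congr_ae h1, lintegral_const_mul, lintegral_lintegral_swap]
  rotate_left
  · exact Measurable.aemeasurable (by fun_prop)
  · refine Measurable.lintegral_prod_right ?_
    fun_prop
  rw [etaMass, ← hb, ENNReal.ofReal_mul (p := π / 2 * (Gamma b)⁻¹ ^ 2) (by positivity)]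
  congr 1
  rw [ENNReal.ofReal_mul (p := (π / 2) ^ n) (by positivity),
    ← lintegral_rpow_mul_one_sub_exp hs hs1, ← lintegral_const_mul _ (by fun_prop)]
  refine setLIntegral_congr_fun measurableSet_Ioi fun y hy => ?_
  have hy' : (0 : ℝ) < y := hy
  have hexp : 0 ≤ 1 - exp (-(2 * y)) := by
    rw [sub_nonneg, exp_le_one_iff]
    linarith
  have h3 : ∀ v : EuclideanSpace ℝ (Fin n) × EuclideanSpace ℝ (Fin n),
      ENNReal.ofReal (y ^ (2 * b - 2) *
        (exp (-(2 * nsq v * y)) - exp (-(2 * (1 + nsq v) * y)))) =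
      ENNReal.ofReal (y ^ (2 * b - 2) * (1 - exp (-(2 * y)))) *
        ENNReal.ofReal (exp (-(2 * nsq v * y))) := by
    intro v
    rw [← ENNReal.ofReal_mul (by positivity), mul_assoc (y ^ (2 * b - 2)), sub_mul, one_mul, ← exp_add]
    congr 4
    ring
  simp_rw [h3]
  rw [lintegral_const_mul _ (by fun_prop), lintegral_exp_nsq hy', ← ENNReal.ofReal_mul
    (by positivity), ← ENNReal.ofReal_mul (by positivity)]
  congr 1
  have h2 : y ^ (2 * b - 2) * y ^ (-(n : ℝ)) = y ^ (-s - 1) := by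
    rw [← rpow_add hy']
    congr 1
    rw [hb]
    ring
  rw [← h2]
  ring

lemma hmul_assoc {n : ℕ} (p q r : Heis n) : hmul (hmul p q) r = hmul p (hmul q r) := by
  refine Prod.ext (add_assoc _ _ _) (Prod.ext (add_assoc _ _ _) ?_)
  simp only [hmul, PiLp.add_apply]
  have h : ∑ j, (p.2.1 j * q.1 j - p.1 j * q.2.1 j) +
      ∑ j, ((p.2.1 j + q.2.1 j) * r.1 j - (p.1 j + q.1 j) * r.2.1 j) =
      ∑ j, (q.2.1 j * r.1 j - q.1 j * r.2.1 j) +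
      ∑ j, (p.2.1 j * (q.1 j + r.1 j) - p.1 j * (q.2.1 j + r.2.1 j)) := by
    rw [← Finset.sum_add_distrib, ← Finset.sum_add_distrib]
    exact Finset.sum_congr rfl fun j _ => by ring
  linear_combination 1 / 2 * h

lemma hmul_hinv_self {n : ℕ} (p : Heis n) : hmul p (hinv p) = 0 := by
  refine Prod.ext (add_neg_cancel _) (Prod.ext (add_neg_cancel _) ?_)
  simp [hmul, hinv]
  refine Finset.sum_eq_zero fun j _ => ?_
  ring

lemma hinv_hinv {n : ℕ} (p : Heis n) : hinv (hinv p) = p := neg_neg p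

lemma hinv_hmul_self {n : ℕ} (p : Heis n) : hmul (hinv p) p = 0 := by
  have := hmul_hinv_self (hinv p)
  rwa [hinv_hinv] at this

lemma hmul_zero {n : ℕ} (p : Heis n) : hmul p 0 = p := by simp [hmul]

lemma zero_hmul {n : ℕ} (p : Heis n) : hmul 0 p = p := by simp [hmul]

lemma hinv_hmul_cancel_left {n : ℕ} (p q : Heis n) : hmul (hinv p) (hmul p q) = q := by
  rw [← hmul_assoc, hinv_hmul_self, zero_hmul]

lemma hmul_hinv_cancel_left {n : ℕ} (p q : Heis n) : hmul p (hmul (hinv p) q) = q := by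
  rw [← hmul_assoc, hmul_hinv_self, zero_hmul]

lemma hinv_hmul {n : ℕ} (p q : Heis n) : hinv (hmul p q) = hmul (hinv q) (hinv p) := by
  refine Prod.ext (neg_add_rev _ _) (Prod.ext (neg_add_rev _ _) ?_)
  simp only [hmul, hinv, PiLp.neg_apply, neg_mul_neg]
  have : ∑ j, (q.2.1 j * p.1 j - q.1 j * p.2.1 j) =
      -∑ j, (p.2.1 j * q.1 j - p.1 j * q.2.1 j) := by
    rw [← Finset.sum_neg_distrib]
    exact Finset.sum_congr rfl fun j _ => by ring
  rw [this]
  ring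

lemma hinv_hmul_hinv {n : ℕ} (p q : Heis n) : hinv (hmul (hinv p) q) = hmul (hinv q) p := by
  rw [hinv_hmul, hinv_hinv]

lemma phiK_hinv {n : ℕ} (s ρ : ℝ) (p : Heis n) : phiK n s ρ (hinv p) = phiK n s ρ p := by
  simp [phiK, hinv]

instance isAddHaarMeasure_volume_prod {E F : Type*} [NormedAddCommGroup E]
    [NormedAddCommGroup F] [MeasureSpace E] [MeasureSpace F] [BorelSpace E] [BorelSpace F]
    [SecondCountableTopology E] [SecondCountableTopology F]
    [SFinite (volume : Measure E)] [SFinite (volume : Measure F)]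
    [(volume : Measure E).IsAddHaarMeasure] [(volume : Measure F).IsAddHaarMeasure] :
    (volume : Measure (E × F)).IsAddHaarMeasure :=
  inferInstanceAs ((volume : Measure E).prod (volume : Measure F)).IsAddHaarMeasure

instance isAddHaarMeasure_volume {n : ℕ} : (volume : Measure (Heis n)).IsAddHaarMeasure :=
  isAddHaarMeasure_volume_prod (E := EuclideanSpace ℝ (Fin n))
    (F := EuclideanSpace ℝ (Fin n) × ℝ)

lemma lintegral_hinv {n : ℕ} (F : Heis n → ℝ≥0∞) : ∫⁻ h, F (hinv h) = ∫⁻ h, F h := by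
  have : (volume : Measure (Heis n)).IsNegInvariant :=
    Measure.IsAddHaarMeasure.isNegInvariant_of_regular _
  exact lintegral_neg_eq_self F



lemma measurable_hmul_left {n : ℕ} (p : Heis n) : Measurable (hmul p) :=
  (continuous_hmul.comp (continuous_const.prodMk continuous_id)).measurable

lemma lintegral_hmul_left {n : ℕ} {F : Heis n → ℝ≥0∞} (hF : Measurable F) (p : Heis n) :
    ∫⁻ h, F (hmul p h) = ∫⁻ h, F h := by
  rw [lintegral_heis (F := fun h => F (hmul p h)) (hF.comp (measurable_hmul_left p)),
    lintegral_heis hF]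
  have h1 : ∀ v : EuclideanSpace ℝ (Fin n) × EuclideanSpace ℝ (Fin n),
      ∫⁻ t, F (hmul p (v.1, v.2, t)) = ∫⁻ t, F (p.1 + v.1, p.2.1 + v.2, t) := by
    intro v
    rw [← lintegral_add_right_eq_self (fun t => F (p.1 + v.1, p.2.1 + v.2, t))
      (p.2.2 + 1 / 2 * ∑ j, (p.2.1 j * v.1 j - p.1 j * v.2 j))]
    refine lintegral_congr fun t => ?_
    simp only [hmul]
    congr 3
    ring
  simp only [h1]
  exact lintegral_add_left_eq_self (μ := volume)
    (fun v : EuclideanSpace ℝ (Fin n) × EuclideanSpace ℝ (Fin n) => ∫⁻ t, F (v.1, v.2, t))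
    (p.1, p.2.1)

lemma lintegral_hinv_hmul {n : ℕ} {F : Heis n → ℝ≥0∞} (hF : Measurable F) (p : Heis n) :
    ∫⁻ q, F (hmul (hinv q) p) = ∫⁻ h, F h := by
  rw [← lintegral_hinv F, ← lintegral_hmul_left (F := fun h => F (hinv h))
    (hF.comp continuous_hinv.measurable) (hinv p)]
  refine lintegral_congr fun q => ?_
  simp only [hinv_hmul_hinv]

lemma lintegral_hmul_hinv_swap {n : ℕ} {F G : Heis n → ℝ≥0∞} (hF : Measurable F)
    (hG : Measurable G) (p : Heis n) :
    ∫⁻ r, F r * G (hmul (hinv r) p) = ∫⁻ q, F (hmul p (hinv q)) * G q := by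
  rw [← lintegral_hinv_hmul (p := p) (F := fun q => F (hmul p (hinv q)) * G q)]
  · refine lintegral_congr fun r => ?_
    rw [hinv_hmul_hinv, hmul_hinv_cancel_left]
  · exact (hF.comp ((measurable_hmul_left p).comp continuous_hinv.measurable)).mul hG

/-- The anisotropic dilation of the Heisenberg group. -/
def dil {n : ℕ} (ρ : ℝ) (p : Heis n) : Heis n := (ρ • p.1, ρ • p.2.1, ρ ^ 2 * p.2.2)

lemma continuous_dil {n : ℕ} : Continuous fun z : ℝ × Heis n => dil z.1 z.2 := by
  unfold dil; fun_prop

lemma dil_zero {n : ℕ} (p : Heis n) : dil 0 p = 0 := by simp [dil]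

lemma lintegral_comp_smul {E : Type*} [NormedAddCommGroup E] [NormedSpace ℝ E]
    [FiniteDimensional ℝ E] [MeasurableSpace E] [BorelSpace E] (μ : Measure E)
    [μ.IsAddHaarMeasure] {r : ℝ} (hr : 0 < r) {F : E → ℝ≥0∞} (hF : Measurable F) :
    ENNReal.ofReal (r ^ Module.finrank ℝ E) * ∫⁻ x, F (r • x) ∂μ = ∫⁻ x, F x ∂μ := by
  rw [← lintegral_map hF (measurable_const_smul r), Measure.map_addHaar_smul μ hr.ne',
    lintegral_smul_measure, smul_eq_mul, ← mul_assoc, ← ENNReal.ofReal_mul (by positivity),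
    abs_of_pos (by positivity), mul_inv_cancel₀ (by positivity), ENNReal.ofReal_one, one_mul]

lemma lintegral_dil {n : ℕ} {ρ : ℝ} (hρ : 0 < ρ) {F : Heis n → ℝ≥0∞} (hF : Measurable F) :
    ENNReal.ofReal (ρ ^ (2 * n + 2)) * ∫⁻ h, F (dil ρ h) = ∫⁻ h, F h := by
  have hd : Measurable (dil (n := n) ρ) :=
    (continuous_dil.comp (continuous_const.prodMk continuous_id)).measurable
  rw [lintegral_heis (F := fun h => F (dil ρ h)) (hF.comp hd), lintegral_heis hF]
  have h1 : ∀ v : EuclideanSpace ℝ (Fin n) × EuclideanSpace ℝ (Fin n),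
      ENNReal.ofReal (ρ ^ 2) * ∫⁻ t, F (dil ρ (v.1, v.2, t)) =
        ∫⁻ t, F (ρ • v.1, ρ • v.2, t) := by
    intro v
    rw [← lintegral_comp_smul volume (r := ρ ^ 2) (by positivity)
      (F := fun t => F (ρ • v.1, ρ • v.2, t)) (hF.comp (by fun_prop))]
    simp [dil]
  have h2 : Measurable fun v : EuclideanSpace ℝ (Fin n) × EuclideanSpace ℝ (Fin n) =>
      ∫⁻ t, F (v.1, v.2, t) :=
    Measurable.lintegral_prod_right' (f := fun z : (EuclideanSpace ℝ (Fin n) ×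
      EuclideanSpace ℝ (Fin n)) × ℝ => F (z.1.1, z.1.2, z.2)) (hF.comp (by fun_prop))
  rw [← lintegral_comp_smul volume hρ h2, Module.finrank_prod, finrank_euclideanSpace_fin,
    ← two_mul, pow_add, ENNReal.ofReal_mul (by positivity), mul_assoc,
    ← lintegral_const_mul' _ _ ENNReal.ofReal_ne_top]
  simp only [h1, Prod.smul_fst, Prod.smul_snd]

lemma phiK_dil {n : ℕ} (s : ℝ) {ρ : ℝ} (hρ : 0 < ρ) (r : ℝ) (p : Heis n) :
    phiK n s (ρ * r) (dil ρ p) = ρ ^ (-(2 * ((n : ℝ) + 1 + s))) * phiK n s r p := by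
  have h4 : ρ ^ (-(2 * ((n : ℝ) + 1 + s))) = (ρ ^ (4 : ℕ)) ^ (-(((n : ℝ) + 1 + s) / 2)) := by
    rw [← rpow_natCast, ← rpow_mul hρ.le]
    congr 1
    push_cast
    ring
  rw [h4]
  unfold phiK dil
  rw [← mul_rpow (by positivity) (by positivity)]
  congr 1
  simp only [norm_smul, norm_eq_abs, mul_pow, sq_abs]
  ring

lemma etaK_dil {n : ℕ} (s : ℝ) {ρ : ℝ} (hρ : 0 < ρ) (p : Heis n) :
    ρ ^ (2 * n + 2) * etaK n s ρ (dil ρ p) = ρ ^ (2 * s) * etaK n s 1 p := by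
  have h1 := phiK_dil (-s) hρ 0 p
  have h2 := phiK_dil (-s) hρ 1 p
  rw [mul_zero] at h1
  rw [mul_one] at h2
  unfold etaK
  rw [h1, h2, ← mul_sub, ← mul_assoc, ← rpow_natCast, ← rpow_add hρ]
  congr 2
  push_cast
  ring

lemma massK_eq {n : ℕ} (s : ℝ) {ρ : ℝ} (hρ : 0 < ρ) :
    massK n s ρ * ρ ^ (2 * s) = massK n s 1 := by
  have : ρ ^ (2 * s) = (ρ ^ 2) ^ s := by
    rw [← rpow_natCast, ← rpow_mul hρ.le]; congr 1
  unfold massK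
  rw [this, mul_rpow (by norm_num) (by positivity), rpow_neg (by positivity : (0:ℝ) ≤ ρ ^ 2)]
  have : (ρ ^ 2) ^ s ≠ 0 := (rpow_pos_of_pos (by positivity) _).ne'
  field_simp

/-- The mollification at scale `ρ` is an average over dilates of a fixed kernel. -/
lemma massK_mul_lintegral_etaK {n : ℕ} {s ρ : ℝ} (hs : 0 < s) (hρ : 0 < ρ)
    {g : Heis n → ℝ≥0∞} (hg : Measurable g) (p : Heis n) :
    ENNReal.ofReal (massK n s ρ) *
        ∫⁻ r, g r * ENNReal.ofReal (etaK n s ρ (hmul (hinv r) p)) =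
      ENNReal.ofReal (massK n s 1) *
        ∫⁻ h, g (hmul p (hinv (dil ρ h))) * ENNReal.ofReal (etaK n s 1 h) := by
  have hG := (measurable_etaK n s ρ).ennreal_ofReal
  rw [lintegral_hmul_hinv_swap hg hG, ← lintegral_dil hρ (F := fun q => g (hmul p (hinv q)) * ENNReal.ofReal (etaK n s ρ q))
    ((hg.comp ((measurable_hmul_left p).comp continuous_hinv.measurable)).mul hG),
    ← massK_eq s hρ, ENNReal.ofReal_mul (massK_pos hs hρ).le, mul_assoc]
  congr 1
  rw [← lintegral_const_mul' _ _ ENNReal.ofReal_ne_top,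
    ← lintegral_const_mul' _ _ ENNReal.ofReal_ne_top]
  refine lintegral_congr fun h => ?_
  rw [mul_left_comm, mul_left_comm (ENNReal.ofReal (ρ ^ (2 * s))), ← ENNReal.ofReal_mul
    (by positivity), ← ENNReal.ofReal_mul (by positivity), etaK_dil s hρ]

lemma continuous_hinv_hmul {n : ℕ} :
    Continuous fun z : Heis n × Heis n => hmul (hinv z.1) z.2 :=
  continuous_hmul.comp ((continuous_hinv.comp continuous_fst).prodMk continuous_snd)

lemma ae_horizontal_pos {n : ℕ} (hn : 1 ≤ n) (p : Heis n) :
    ∀ᵐ r : Heis n, 0 < ‖(hmul (hinv r) p).1‖ ^ 2 + ‖(hmul (hinv r) p).2.1‖ ^ 2 := by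
  have hS : MeasurableSet {h : Heis n | ‖h.1‖ ^ 2 + ‖h.2.1‖ ^ 2 ≤ 0} :=
    measurableSet_le (by fun_prop) measurable_const
  have hF : Measurable ({h : Heis n | ‖h.1‖ ^ 2 + ‖h.2.1‖ ^ 2 ≤ 0}.indicator
    (1 : Heis n → ℝ≥0∞)) := measurable_one.indicator hS
  have h0 : ∫⁻ h, {h : Heis n | ‖h.1‖ ^ 2 + ‖h.2.1‖ ^ 2 ≤ 0}.indicator
      (1 : Heis n → ℝ≥0∞) h = 0 := by
    rw [lintegral_heis hF, ← lintegral_zero (α := EuclideanSpace ℝ (Fin n) ×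
      EuclideanSpace ℝ (Fin n)) (μ := volume)]
    refine lintegral_congr_ae ?_
    filter_upwards [ae_nsq_pos hn] with v hv
    have : ∀ t : ℝ, {h : Heis n | ‖h.1‖ ^ 2 + ‖h.2.1‖ ^ 2 ≤ 0}.indicator
        (1 : Heis n → ℝ≥0∞) (v.1, v.2, t) = 0 := fun t =>
      indicator_of_notMem (by simpa [nsq] using hv) _
    simp [this]
  have hm := (measurable_hmul_hinv_left p) hS
  have h := lintegral_hinv_hmul hF p
  rw [h0] at h
  simp only [ae_iff, not_lt]
  exact (lintegral_indicator_one hm).symm.trans h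

/-- The convolution of `g` with the fundamental solution `|·|^{-(Q-2s)}`. -/
def potE {n : ℕ} (s : ℝ) (g : Heis n → ℝ≥0∞) (p : Heis n) : ℝ≥0∞ :=
  ∫⁻ r, g r * ENNReal.ofReal (phiK n (-s) 0 (hmul (hinv r) p))

lemma measurable_potE {n : ℕ} (s : ℝ) {g : Heis n → ℝ≥0∞} (hg : Measurable g) :
    Measurable (potE s g) := by
  have := (measurable_phiK n (-s) 0).comp (continuous_hinv_hmul (n := n)).measurable
  exact Measurable.lintegral_prod_left' (f := fun z : Heis n × Heis n =>
    g z.1 * ENNReal.ofReal (phiK n (-s) 0 (hmul (hinv z.1) z.2)))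
    ((hg.comp measurable_fst).mul this.ennreal_ofReal)

lemma lintegral_mul_kernel_swap {X : Type*} [MeasurableSpace X] {μ : Measure X} [SFinite μ]
    {g k : X → ℝ≥0∞} {e : X → X → ℝ≥0∞} (hg : Measurable g)
    (he : Measurable fun z : X × X => e z.1 z.2) (hk : Measurable k) :
    ∫⁻ q, (∫⁻ r, g r * e r q ∂μ) * k q ∂μ = ∫⁻ r, g r * ∫⁻ q, e r q * k q ∂μ ∂μ := by
  have hm : Measurable fun z : X × X => g z.2 * e z.2 z.1 * k z.1 :=
    ((hg.comp measurable_snd).mul (he.comp measurable_swap)).mul (hk.comp measurable_fst)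
  have h1 : ∀ q, Measurable fun r => g r * e r q := fun q =>
    hg.mul (he.comp (measurable_id.prodMk measurable_const))
  have h2 : ∀ r, Measurable fun q => e r q * k q := fun r =>
    (he.comp (measurable_const.prodMk measurable_id)).mul hk
  simp_rw [← lintegral_mul_const _ (h1 _), ← lintegral_const_mul _ (h2 _)]
  rw [lintegral_lintegral_swap hm.aemeasurable]
  simp_rw [mul_assoc]

lemma lintegral_potE_mul_phiK {n : ℕ} (hn : 1 ≤ n) {s ρ : ℝ} (hs : 0 < s) (hs1 : s < 1)
    (hρ : 0 < ρ) {g : Heis n → ℝ≥0∞} (hg : Measurable g) (p : Heis n) :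
    ∫⁻ q, potE s g q * ENNReal.ofReal (phiK n s ρ (hmul (hinv q) p)) =
      ENNReal.ofReal (massK n s ρ) *
        ∫⁻ r, g r * ENNReal.ofReal (phiK n (-s) ρ (hmul (hinv r) p)) := by
  have hE : Measurable fun z : Heis n × Heis n =>
      ENNReal.ofReal (phiK n (-s) 0 (hmul (hinv z.1) z.2)) :=
    ((measurable_phiK n (-s) 0).comp continuous_hinv_hmul.measurable).ennreal_ofReal
  have hK : Measurable fun q : Heis n => ENNReal.ofReal (phiK n s ρ (hmul (hinv q) p)) :=
    ((measurable_phiK n s ρ).comp (measurable_hmul_hinv_left p)).ennreal_ofReal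
  have hin : ∀ r, ∫⁻ q, ENNReal.ofReal (phiK n (-s) 0 (hmul (hinv r) q)) *
      ENNReal.ofReal (phiK n s ρ (hmul (hinv q) p)) =
      ENNReal.ofReal (massK n s ρ * phiK n (-s) ρ (hmul (hinv r) p)) := by
    intro r
    have hEr : Measurable fun q => ENNReal.ofReal (phiK n (-s) 0 (hmul (hinv r) q)) *
        ENNReal.ofReal (phiK n s ρ (hmul (hinv q) p)) :=
      (hE.comp (measurable_const.prodMk measurable_id)).mul hK
    rw [← lintegral_phiK_mul_phiK hn hs hs1 hρ, ← lintegral_hmul_left hEr r]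
    refine lintegral_congr fun h => ?_
    rw [hinv_hmul_cancel_left, hinv_hmul, hmul_assoc, ENNReal.ofReal_mul (phiK_nonneg _ _ _ _)]
  have h1 := lintegral_mul_kernel_swap (μ := volume)
    (e := fun r q => ENNReal.ofReal (phiK n (-s) 0 (hmul (hinv r) q))) hg hE hK
  simp only [hin, ENNReal.ofReal_mul (massK_pos hs hρ).le,
    mul_left_comm _ (ENNReal.ofReal (massK n s ρ))] at h1
  rw [lintegral_const_mul' _ _ ENNReal.ofReal_ne_top] at h1
  exact h1

lemma picone_real {a b x y : ℝ} (hx : 0 < x) (hy : 0 < y) :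
    a ^ 2 + b ^ 2 ≤ (a - b) ^ 2 + (a ^ 2 * (y / x) + b ^ 2 * (x / y)) := by
  have h : (a - b) ^ 2 + (a ^ 2 * (y / x) + b ^ 2 * (x / y)) - (a ^ 2 + b ^ 2) =
      (a * y - b * x) ^ 2 / (x * y) := by
    field_simp
    ring
  have : 0 ≤ (a * y - b * x) ^ 2 / (x * y) := by positivity
  linarith

lemma picone_ennreal (a b : ℝ) {x y : ℝ≥0∞} (hx : x ≠ 0) (hx' : x ≠ ∞) (hy : y ≠ 0)
    (hy' : y ≠ ∞) :
    ENNReal.ofReal (a ^ 2) + ENNReal.ofReal (b ^ 2) ≤ ENNReal.ofReal ((a - b) ^ 2) +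
      (ENNReal.ofReal (a ^ 2) / x * y + ENNReal.ofReal (b ^ 2) / y * x) := by
  have h1 := ENNReal.toReal_pos hx hx'
  have h2 := ENNReal.toReal_pos hy hy'
  rw [← ENNReal.ofReal_toReal hx', ← ENNReal.ofReal_toReal hy', ← ENNReal.ofReal_div_of_pos h1,
    ← ENNReal.ofReal_div_of_pos h2, ← ENNReal.ofReal_mul (by positivity),
    ← ENNReal.ofReal_mul (by positivity), ← ENNReal.ofReal_add (by positivity) (by positivity),
    ← ENNReal.ofReal_add (by positivity) (by positivity),
    ← ENNReal.ofReal_add (by positivity) (by positivity)]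
  refine ENNReal.ofReal_le_ofReal ((picone_real h1 h2).trans (le_of_eq ?_))
  ring

lemma potE_eq_add {n : ℕ} (hn : 1 ≤ n) {s ρ : ℝ} (hs1 : s < 1)
    {g : Heis n → ℝ≥0∞} (hg : Measurable g) (p : Heis n) :
    potE s g p = (∫⁻ r, g r * ENNReal.ofReal (phiK n (-s) ρ (hmul (hinv r) p))) +
      ∫⁻ r, g r * ENNReal.ofReal (etaK n s ρ (hmul (hinv r) p)) := by
  have hn' : (1 : ℝ) ≤ n := by exact_mod_cast hn
  have hK : Measurable fun r => g r * ENNReal.ofReal (phiK n (-s) ρ (hmul (hinv r) p)) :=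
    hg.mul ((measurable_phiK n (-s) ρ).comp (measurable_hmul_hinv_left p)).ennreal_ofReal
  rw [← lintegral_add_left hK]
  refine lintegral_congr_ae ?_
  filter_upwards [ae_horizontal_pos hn p] with r hr
  rw [← mul_add, ← ENNReal.ofReal_add (phiK_nonneg _ _ _ _)
    (etaK_nonneg (by linarith) ρ hr), etaK, add_sub_cancel]

/-- Picone's inequality integrated against a symmetric kernel `K` of constant mass `M`:
if `K P + R = M P`, the Dirichlet form of `K` controls the potential `R / P`. -/
lemma picone_kernel {X : Type*} [MeasurableSpace X] {μ : Measure X} [SFinite μ]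
    {K : X → X → ℝ≥0∞} (hK : Measurable (Function.uncurry K)) (hsymm : ∀ p q, K p q = K q p)
    {M : ℝ≥0∞} (hM : ∀ p, ∫⁻ q, K p q ∂μ = M) (hM' : M ≠ ∞) {P R : X → ℝ≥0∞}
    (hP : Measurable P) (hpos : ∀ p, P p ≠ 0) (hfin : ∀ p, P p ≠ ∞)
    (hR : ∀ p, ∫⁻ q, P q * K p q ∂μ + R p = M * P p) {f : X → ℝ} (hf : Measurable f)
    (hf2 : ∫⁻ p, ENNReal.ofReal (f p ^ 2) ∂μ ≠ ∞) :
    2 * ∫⁻ p, ENNReal.ofReal (f p ^ 2) / P p * R p ∂μ ≤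
      ∫⁻ p, ∫⁻ q, ENNReal.ofReal ((f p - f q) ^ 2) * K p q ∂μ ∂μ := by
  set F : X → ℝ≥0∞ := fun p => ENNReal.ofReal (f p ^ 2) with hF
  have hFm : Measurable F := (hf.pow_const 2).ennreal_ofReal
  have hF1 : Measurable fun z : X × X => F z.1 := hFm.comp measurable_fst
  have hF2 : Measurable fun z : X × X => F z.2 := hFm.comp measurable_snd
  have hP1 : Measurable fun z : X × X => P z.1 := hP.comp measurable_fst
  have hP2 : Measurable fun z : X × X => P z.2 := hP.comp measurable_snd
  have hKm : Measurable fun z : X × X => K z.1 z.2 := hK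
  have hKp : ∀ p, Measurable (K p) := fun p => hK.comp (measurable_const.prodMk measurable_id)
  set S := ∫⁻ p, ∫⁻ q, F p * K p q ∂μ ∂μ with hS
  set J := ∫⁻ p, ∫⁻ q, F p / P p * P q * K p q ∂μ ∂μ with hJ
  have hS2 : ∫⁻ p, ∫⁻ q, F q * K p q ∂μ ∂μ = S := by
    rw [lintegral_lintegral_swap (hF2.mul hKm).aemeasurable, hS]
    refine lintegral_congr fun p => lintegral_congr fun q => ?_
    rw [hsymm]
  have hJ2 : ∫⁻ p, ∫⁻ q, F q / P q * P p * K p q ∂μ ∂μ = J := by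
    rw [lintegral_lintegral_swap (((hF2.div hP2).mul hP1).mul hKm).aemeasurable, hJ]
    refine lintegral_congr fun p => lintegral_congr fun q => ?_
    rw [hsymm]
  have hSM : S = M * ∫⁻ p, F p ∂μ := by
    rw [hS, ← lintegral_const_mul _ hFm]
    refine lintegral_congr fun p => ?_
    rw [lintegral_const_mul _ (hKp p), hM, mul_comm]
  have hJm : Measurable fun p => ∫⁻ q, F p / P p * P q * K p q ∂μ :=
    Measurable.lintegral_prod_right' (f := fun z : X × X => F z.1 / P z.1 * P z.2 * K z.1 z.2)
      (((hF1.div hP1).mul hP2).mul hKm)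
  have hSJ : S = J + ∫⁻ p, F p / P p * R p ∂μ := by
    rw [hSM, hJ, ← lintegral_const_mul _ hFm, ← lintegral_add_left hJm]
    refine lintegral_congr fun p => ?_
    simp_rw [mul_assoc]
    have hPK : Measurable fun q => P q * K p q := hP.mul (hKp p)
    rw [lintegral_const_mul _ hPK, ← mul_add, hR, mul_left_comm,
      ENNReal.div_mul_cancel (hpos p) (hfin p)]
  have hSfin : S ≠ ∞ := hSM ▸ ENNReal.mul_ne_top hM' hf2
  have hJfin : J ≠ ∞ := ne_top_of_le_ne_top hSfin (hSJ ▸ le_self_add)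
  have hadd : ∀ {G H : X → X → ℝ≥0∞}, Measurable (fun z : X × X => G z.1 z.2) →
      ∫⁻ p, ∫⁻ q, (G p q + H p q) ∂μ ∂μ =
        ∫⁻ p, ∫⁻ q, G p q ∂μ ∂μ + ∫⁻ p, ∫⁻ q, H p q ∂μ ∂μ := by
    intro G H hG
    rw [← lintegral_add_left (Measurable.lintegral_prod_right' hG)]
    refine lintegral_congr fun p => lintegral_add_left ?_ _
    exact hG.comp (measurable_const.prodMk measurable_id)
  have hSm : Measurable fun z : X × X => F z.1 * K z.1 z.2 := hF1.mul hKm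
  have hJm' : Measurable fun z : X × X => F z.1 / P z.1 * P z.2 * K z.1 z.2 :=
    ((hF1.div hP1).mul hP2).mul hKm
  have hDm : Measurable fun z : X × X => ENNReal.ofReal ((f z.1 - f z.2) ^ 2) * K z.1 z.2 :=
    (((hf.comp measurable_fst).sub (hf.comp measurable_snd)).pow_const 2).ennreal_ofReal.mul hKm
  have hmain : S + S ≤
      (∫⁻ p, ∫⁻ q, ENNReal.ofReal ((f p - f q) ^ 2) * K p q ∂μ ∂μ) + (J + J) := by
    nth_rewrite 2 [← hS2]
    nth_rewrite 2 [← hJ2]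
    rw [hS, hJ, ← hadd hSm, ← hadd hJm', ← hadd hDm]
    refine lintegral_mono fun p => lintegral_mono fun q => ?_
    simp only [← add_mul]
    exact mul_le_mul_left (picone_ennreal _ _ (hpos p) (hfin p) (hpos q) (hfin q)) _
  have h2 : S + S = 2 * (∫⁻ p, F p / P p * R p ∂μ) + (J + J) := by
    rw [hSJ]; ring
  rw [h2] at hmain
  exact (ENNReal.add_le_add_iff_right (ENNReal.add_ne_top.2 ⟨hJfin, hJfin⟩)).1 hmain

lemma gagliardo_ge_of_scale {n : ℕ} (hn : 1 ≤ n) {s ρ : ℝ} (hs : 0 < s) (hs1 : s < 1)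
    (hρ : 0 < ρ) {g : Heis n → ℝ≥0∞} (hg : Measurable g) (hpos : ∀ p, potE s g p ≠ 0)
    (hfin : ∀ p, potE s g p ≠ ∞) {f : Heis n → ℝ} (hf : Measurable f)
    (hf2 : ∫⁻ p, ENNReal.ofReal (f p ^ 2) ≠ ∞) :
    2 * ∫⁻ p, ENNReal.ofReal (f p ^ 2) / potE s g p * (ENNReal.ofReal (massK n s ρ) *
        ∫⁻ r, g r * ENNReal.ofReal (etaK n s ρ (hmul (hinv r) p))) ≤
      ∫⁻ p, ∫⁻ q, ENNReal.ofReal ((f p - f q) ^ 2) *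
        ENNReal.ofReal (phiK n s ρ (hmul (hinv q) p)) := by
  have hKm := (((measurable_phiK n s ρ).comp (continuous_hinv_hmul (n := n)).measurable).comp
      measurable_swap).ennreal_ofReal
  refine picone_kernel (K := fun p q => ENNReal.ofReal (phiK n s ρ (hmul (hinv q) p)))
    (M := ENNReal.ofReal (massK n s ρ)) hKm (fun p q => ?_) (fun p => ?_) ENNReal.ofReal_ne_top
    (measurable_potE s hg) hpos hfin (fun p => ?_) hf hf2
  · rw [← phiK_hinv, hinv_hmul_hinv]
  · rw [← lintegral_phiK hn hs hρ]
    exact lintegral_hinv_hmul (measurable_phiK n s ρ).ennreal_ofReal p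
  · rw [lintegral_potE_mul_phiK hn hs hs1 hρ hg, ← mul_add, ← potE_eq_add hn hs1 hg p]

lemma quartic_pos {n : ℕ} {p : Heis n} (hp : p ≠ 0) :
    0 < (‖p.1‖ ^ 2 + ‖p.2.1‖ ^ 2) ^ 2 + 16 * p.2.2 ^ 2 := by
  by_contra h
  have h1 : ‖p.1‖ ^ 2 + ‖p.2.1‖ ^ 2 = 0 := by
    nlinarith [sq_nonneg (‖p.1‖ ^ 2 + ‖p.2.1‖ ^ 2), sq_nonneg p.2.2]
  have h2 : p.2.2 = 0 := by
    nlinarith [sq_nonneg (‖p.1‖ ^ 2 + ‖p.2.1‖ ^ 2), sq_nonneg p.2.2]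
  have h3 : ‖p.1‖ = 0 := by nlinarith [sq_nonneg ‖p.1‖, sq_nonneg ‖p.2.1‖]
  have h4 : ‖p.2.1‖ = 0 := by nlinarith [sq_nonneg ‖p.1‖, sq_nonneg ‖p.2.1‖]
  exact hp (Prod.ext (norm_eq_zero.1 h3) (Prod.ext (norm_eq_zero.1 h4) h2))

lemma phiS_nonneg (n : ℕ) (s : ℝ) (p : Heis n) : 0 ≤ phiS n s p := by
  unfold phiS; positivity

lemma measurable_phiS (n : ℕ) (s : ℝ) : Measurable (phiS n s) := by
  unfold phiS; fun_prop

lemma phiS_pos {n : ℕ} (s : ℝ) {p : Heis n} (hp : p ≠ 0) : 0 < phiS n s p :=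
  rpow_pos_of_pos (quartic_pos hp) _

lemma continuousAt_phiS {n : ℕ} (s : ℝ) {p : Heis n} (hp : p ≠ 0) :
    ContinuousAt (phiS n s) p :=
  ContinuousAt.rpow_const (by fun_prop) (Or.inl (quartic_pos hp).ne')

lemma phiK_one_pos {n : ℕ} (s : ℝ) (p : Heis n) : 0 < phiK n s 1 p := by
  unfold phiK; positivity

lemma phiK_one_le_one {n : ℕ} {s : ℝ} (hs : 0 ≤ (n : ℝ) + 1 + s) (p : Heis n) :
    phiK n s 1 p ≤ 1 := by
  refine rpow_le_one_of_one_le_of_nonpos ?_ (by linarith)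
  nlinarith [sq_nonneg ‖p.1‖, sq_nonneg ‖p.2.1‖, sq_nonneg p.2.2,
    sq_nonneg (‖p.1‖ ^ 2 + ‖p.2.1‖ ^ 2)]

lemma continuous_phiK_one {n : ℕ} (s : ℝ) : Continuous (phiK n s 1) := by
  unfold phiK
  refine Continuous.rpow_const (by fun_prop) fun p => Or.inl ?_
  positivity

/-- A bounded integrable truncation of `phiS`. -/
def truncS (n : ℕ) (s : ℝ) (N : ℕ) (p : Heis n) : ℝ≥0∞ :=
  ENNReal.ofReal (min (phiS n s p) (N * phiK n s 1 p))

lemma measurable_truncS (n : ℕ) (s : ℝ) (N : ℕ) : Measurable (truncS n s N) :=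
  ((measurable_phiS n s).min ((measurable_phiK n s 1).const_mul _)).ennreal_ofReal

lemma truncS_le_phiS (n : ℕ) (s : ℝ) (N : ℕ) (p : Heis n) :
    truncS n s N p ≤ ENNReal.ofReal (phiS n s p) :=
  ENNReal.ofReal_le_ofReal (min_le_left _ _)

lemma truncS_le_phiK (n : ℕ) (s : ℝ) (N : ℕ) (p : Heis n) :
    truncS n s N p ≤ N * ENNReal.ofReal (phiK n s 1 p) := by
  rw [← ENNReal.ofReal_natCast, ← ENNReal.ofReal_mul (by positivity)]
  exact ENNReal.ofReal_le_ofReal (min_le_right _ _)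

lemma truncS_ne_zero {n : ℕ} (s : ℝ) {N : ℕ} (hN : 1 ≤ N) {p : Heis n} (hp : p ≠ 0) :
    truncS n s N p ≠ 0 := by
  have hN' : (0 : ℝ) < N := by exact_mod_cast hN
  have := phiK_one_pos s p
  simp only [truncS, ne_eq, ENNReal.ofReal_eq_zero, not_le, lt_min_iff]
  exact ⟨phiS_pos s hp, by positivity⟩

lemma continuousAt_truncS {n : ℕ} (s : ℝ) (N : ℕ) {p : Heis n} (hp : p ≠ 0) :
    ContinuousAt (truncS n s N) p :=
  ENNReal.continuous_ofReal.continuousAt.comp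
    ((continuousAt_phiS s hp).min ((continuous_phiK_one s).const_mul _).continuousAt)

lemma tendsto_truncS {n : ℕ} (s : ℝ) (p : Heis n) :
    Tendsto (fun N => truncS n s N p) atTop (𝓝 (ENNReal.ofReal (phiS n s p))) := by
  have h := phiK_one_pos s p
  obtain ⟨N₀, hN₀⟩ := exists_nat_ge (phiS n s p / phiK n s 1 p)
  refine tendsto_atTop_of_eventually_const (i₀ := N₀) fun N hN => ?_
  rw [truncS, min_eq_left]
  have : (N₀ : ℝ) ≤ N := by exact_mod_cast hN
  rw [div_le_iff₀ h] at hN₀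
  nlinarith

lemma ae_ne_zero {n : ℕ} (hn : 1 ≤ n) : ∀ᵐ p : Heis n, p ≠ 0 := by
  filter_upwards [ae_horizontal_pos hn 0] with r hr
  rintro rfl
  simp [hinv, hmul] at hr

lemma potE_truncS_ne_zero {n : ℕ} (hn : 1 ≤ n) (s : ℝ) {N : ℕ} (hN : 1 ≤ N) (p : Heis n) :
    potE s (truncS n s N) p ≠ 0 := by
  have hm : Measurable fun r =>
      truncS n s N r * ENNReal.ofReal (phiK n (-s) 0 (hmul (hinv r) p)) :=
    (measurable_truncS n s N).mul
      ((measurable_phiK n (-s) 0).comp (measurable_hmul_hinv_left p)).ennreal_ofReal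
  have hv : (volume : Measure (Heis n)) ≠ 0 := NeZero.ne _
  intro h
  rw [potE, lintegral_eq_zero_iff hm] at h
  have : ∀ᵐ r : Heis n, False := by
    filter_upwards [h, ae_ne_zero hn, ae_horizontal_pos hn p] with r hr h1 h2
    refine (mul_ne_zero (truncS_ne_zero s hN h1) ?_) hr
    rw [ne_eq, ENNReal.ofReal_eq_zero, not_le]
    unfold phiK
    positivity
  rw [ae_iff] at this
  simp only [not_false_eq_true, Set.ofPred_true, Measure.measure_univ_eq_zero] at this
  exact hv this

lemma potE_truncS_ne_top {n : ℕ} (hn : 1 ≤ n) {s : ℝ} (hs : 0 < s) (hs1 : s < 1) (N : ℕ)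
    (p : Heis n) : potE s (truncS n s N) p ≠ ∞ := by
  have hn' : (1 : ℝ) ≤ n := by exact_mod_cast hn
  have hle : ∀ r, truncS n s N r ≤ N := fun r =>
    (truncS_le_phiK n s N r).trans (mul_le_of_le_one_right' (ENNReal.ofReal_le_one.2
      (phiK_one_le_one (by linarith) r)))
  rw [potE_eq_add hn hs1 (measurable_truncS n s N) (ρ := 1) p]
  refine ENNReal.add_ne_top.2 ⟨ne_top_of_le_ne_top (b := N * ENNReal.ofReal (massK n s 1)) ?_ ?_,
    ne_top_of_le_ne_top (b := N * ENNReal.ofReal (etaMass n s)) ?_ ?_⟩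
  · exact ENNReal.mul_ne_top (ENNReal.natCast_ne_top N) ENNReal.ofReal_ne_top
  · rw [← lintegral_phiK hn hs one_pos, ← lintegral_const_mul' _ _ (ENNReal.natCast_ne_top N)]
    refine lintegral_mono fun r => ?_
    exact (mul_le_of_le_one_right' (ENNReal.ofReal_le_one.2
      (phiK_one_le_one (by linarith) _))).trans (truncS_le_phiK n s N r)
  · exact ENNReal.mul_ne_top (ENNReal.natCast_ne_top N) ENNReal.ofReal_ne_top
  · rw [← lintegral_etaK hn hs hs1, ← lintegral_hinv_hmul (measurable_etaK n s 1).ennreal_ofReal p,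
      ← lintegral_const_mul' _ _ (ENNReal.natCast_ne_top N)]
    exact lintegral_mono fun r => mul_le_mul_left (hle r) _

lemma phiK_le_phiK_zero {n : ℕ} {s : ℝ} (hs : 0 ≤ (n : ℝ) + 1 + s) (ρ : ℝ) {p : Heis n}
    (hp : p ≠ 0) : phiK n s ρ p ≤ phiK n s 0 p := by
  have h := quartic_pos hp
  unfold phiK
  refine rpow_le_rpow_of_nonpos ?_ ?_ (by linarith)
  · rwa [zero_pow two_ne_zero, zero_add]
  · rw [zero_pow two_ne_zero, zero_add]
    exact add_le_add_left (pow_le_pow_left₀ (by positivity)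
      (le_add_of_nonneg_left (sq_nonneg ρ)) 2) _

lemma gagliardo_scale_le {n : ℕ} {s : ℝ} (hs : 0 ≤ (n : ℝ) + 1 + s) (ρ : ℝ) (f : Heis n → ℝ) :
    ∫⁻ p, ∫⁻ q, ENNReal.ofReal ((f p - f q) ^ 2) *
        ENNReal.ofReal (phiK n s ρ (hmul (hinv q) p)) ≤
      ∫⁻ p, ∫⁻ q, ENNReal.ofReal ((f p - f q) ^ 2) *
        ENNReal.ofReal (phiK n s 0 (hmul (hinv q) p)) := by
  refine lintegral_mono fun p => lintegral_mono fun q => ?_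
  by_cases h : hmul (hinv q) p = 0
  · have : p = q := by rw [← hmul_hinv_cancel_left q p, h, hmul_zero]
    simp [this]
  · exact mul_le_mul_right (ENNReal.ofReal_le_ofReal (phiK_le_phiK_zero hs ρ h)) _

/-- Fatou's lemma for averages over shrinking dilates. -/
lemma lintegral_le_of_dilates {n : ℕ} {G g η : Heis n → ℝ≥0∞} (hG : Measurable G)
    (hg : Measurable g) (hη : Measurable η) (hc : ∀ᵐ p, ContinuousAt g p)
    (hη' : ∀ h, η h ≠ ∞) (hG' : ∀ p, G p ≠ ∞) {I : ℝ≥0∞}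
    (hI : ∀ ρ : ℝ, 0 < ρ → ∫⁻ p, G p * ∫⁻ h, g (hmul p (hinv (dil ρ h))) * η h ≤ I) :
    (∫⁻ p, G p * g p) * ∫⁻ h, η h ≤ I := by
  set ρ : ℕ → ℝ := fun m => 1 / ((m : ℝ) + 1) with hρ
  have hρ0 : Tendsto ρ atTop (𝓝 0) := tendsto_one_div_add_atTop_nhds_zero_nat
  have hmap : ∀ m, Measurable fun z : Heis n × Heis n => hmul z.1 (hinv (dil (ρ m) z.2)) :=
    fun m => (continuous_hmul.comp (continuous_fst.prodMk (continuous_hinv.comp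
      (continuous_dil.comp (continuous_const.prodMk continuous_snd))))).measurable
  have hm : ∀ m, Measurable fun z : Heis n × Heis n =>
      G z.1 * (g (hmul z.1 (hinv (dil (ρ m) z.2))) * η z.2) := fun m =>
    (hG.comp measurable_fst).mul ((hg.comp (hmap m)).mul (hη.comp measurable_snd))
  have hlim : ∀ p, ContinuousAt g p → ∀ h, Tendsto
      (fun m => G p * (g (hmul p (hinv (dil (ρ m) h))) * η h)) atTop (𝓝 (G p * (g p * η h))) := by
    intro p hp h
    have h1 : Tendsto (fun m => hmul p (hinv (dil (ρ m) h))) atTop (𝓝 p) := by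
      have hc' : Continuous fun r : ℝ => hmul p (hinv (dil r h)) :=
        continuous_hmul.comp (continuous_const.prodMk (continuous_hinv.comp
          (continuous_dil.comp (continuous_id.prodMk continuous_const))))
      have h2 := (hc'.tendsto 0).comp hρ0
      have h3 : hmul p (hinv (dil 0 h)) = p := by
        rw [dil_zero]; simp [hinv, hmul]
      rwa [h3] at h2
    exact ENNReal.Tendsto.const_mul (ENNReal.Tendsto.mul_const (hp.tendsto.comp h1)
      (Or.inr (hη' h))) (Or.inr (hG' p))
  calc (∫⁻ p, G p * g p) * ∫⁻ h, η h
      = ∫⁻ p, ∫⁻ h, G p * (g p * η h) := by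
        have hGg : Measurable fun p => G p * g p := hG.mul hg
        rw [← lintegral_mul_const _ hGg]
        refine lintegral_congr fun p => ?_
        rw [← lintegral_const_mul _ hη]
        exact lintegral_congr fun h => mul_assoc _ _ _
    _ ≤ ∫⁻ p, liminf (fun m => ∫⁻ h, G p * (g (hmul p (hinv (dil (ρ m) h))) * η h)) atTop := by
        refine lintegral_mono_ae ?_
        filter_upwards [hc] with p hp
        calc ∫⁻ h, G p * (g p * η h)
            = ∫⁻ h, liminf (fun m => G p * (g (hmul p (hinv (dil (ρ m) h))) * η h)) atTop :=
              lintegral_congr fun h => (hlim p hp h).liminf_eq.symm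
          _ ≤ _ := lintegral_liminf_le fun m =>
              (hm m).comp (measurable_const.prodMk measurable_id)
    _ ≤ liminf (fun m => ∫⁻ p, ∫⁻ h, G p * (g (hmul p (hinv (dil (ρ m) h))) * η h)) atTop :=
        lintegral_liminf_le fun m => Measurable.lintegral_prod_right' (hm m)
    _ ≤ liminf (fun _ => I) atTop := by
        refine liminf_le_liminf (Eventually.of_forall fun m => ?_)
        refine le_trans (le_of_eq ?_) (hI (ρ m) (by simp only [hρ]; positivity))
        refine lintegral_congr fun p => lintegral_const_mul' _ _ (hG' p)
    _ = I := liminf_const I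

lemma gagliardo_ge_truncS {n : ℕ} (hn : 1 ≤ n) {s : ℝ} (hs : 0 < s) (hs1 : s < 1)
    {f : Heis n → ℝ} (hf : Measurable f) (hf2 : ∫⁻ p, ENNReal.ofReal (f p ^ 2) ≠ ∞)
    {N : ℕ} (hN : 1 ≤ N) :
    2 * (ENNReal.ofReal (massK n s 1) * ENNReal.ofReal (etaMass n s)) *
        ∫⁻ p, ENNReal.ofReal (f p ^ 2) / potE s (truncS n s N) p * truncS n s N p ≤
      ∫⁻ p, ∫⁻ q, ENNReal.ofReal ((f p - f q) ^ 2) *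
        ENNReal.ofReal (phiK n s 0 (hmul (hinv q) p)) := by
  have hn' : (1 : ℝ) ≤ n := by exact_mod_cast hn
  have hpos := potE_truncS_ne_zero hn s hN
  have hfin := potE_truncS_ne_top hn hs hs1 N
  have hg := measurable_truncS n s N
  set G : Heis n → ℝ≥0∞ := fun p => 2 * ENNReal.ofReal (massK n s 1) *
    (ENNReal.ofReal (f p ^ 2) / potE s (truncS n s N) p) with hGdef
  have hG : Measurable G :=
    ((hf.pow_const 2).ennreal_ofReal.div (measurable_potE s hg)).const_mul _
  have hG' : ∀ p, G p ≠ ∞ := fun p => ENNReal.mul_ne_top (ENNReal.mul_ne_top (by norm_num)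
    ENNReal.ofReal_ne_top) (ENNReal.div_ne_top ENNReal.ofReal_ne_top (hpos p))
  have h := lintegral_le_of_dilates hG hg (measurable_etaK n s 1).ennreal_ofReal
    (by filter_upwards [ae_ne_zero hn] with p hp using continuousAt_truncS s N hp)
    (fun _ => ENNReal.ofReal_ne_top) hG' fun ρ hρ => by
      refine le_trans (le_of_eq ?_) ((gagliardo_ge_of_scale hn hs hs1 hρ hg hpos hfin hf hf2).trans
        (gagliardo_scale_le (by linarith) ρ f))
      rw [← lintegral_const_mul' _ _ (by norm_num)]
      refine lintegral_congr fun p => ?_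
      rw [massK_mul_lintegral_etaK hs hρ hg]
      simp only [hGdef]
      ring
  refine le_trans (le_of_eq ?_) h
  rw [lintegral_etaK hn hs hs1]
  simp only [hGdef, mul_assoc]
  rw [lintegral_const_mul' _ _ (by norm_num), lintegral_const_mul' _ _ ENNReal.ofReal_ne_top]
  ring

lemma gagliardo_ge_phiS {n : ℕ} (hn : 1 ≤ n) {s : ℝ} (hs : 0 < s) (hs1 : s < 1)
    {f : Heis n → ℝ} (hf : Measurable f) (hf2 : ∫⁻ p, ENNReal.ofReal (f p ^ 2) ≠ ∞) :
    2 * (ENNReal.ofReal (massK n s 1) * ENNReal.ofReal (etaMass n s)) *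
        ∫⁻ p, ENNReal.ofReal (f p ^ 2) / potE s (fun r => ENNReal.ofReal (phiS n s r)) p *
          ENNReal.ofReal (phiS n s p) ≤
      ∫⁻ p, ∫⁻ q, ENNReal.ofReal ((f p - f q) ^ 2) *
        ENNReal.ofReal (phiK n s 0 (hmul (hinv q) p)) := by
  set P := potE s (fun r : Heis n => ENNReal.ofReal (phiS n s r)) with hP
  set c := 2 * (ENNReal.ofReal (massK n s 1) * ENNReal.ofReal (etaMass n s)) with hc
  set I := ∫⁻ p, ∫⁻ q, ENNReal.ofReal ((f p - f q) ^ 2) *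
        ENNReal.ofReal (phiK n s 0 (hmul (hinv q) p)) with hI
  have hcfin : c ≠ ∞ := ENNReal.mul_ne_top (by norm_num)
    (ENNReal.mul_ne_top ENNReal.ofReal_ne_top ENNReal.ofReal_ne_top)
  have hPm : Measurable P := measurable_potE s (measurable_phiS n s).ennreal_ofReal
  have hle : ∀ N p, potE s (truncS n s N) p ≤ P p := fun N p =>
    lintegral_mono fun r => mul_le_mul_left (truncS_le_phiS n s N r) _
  have hP0 : ∀ p, P p ≠ 0 := fun p h =>
    potE_truncS_ne_zero hn s le_rfl p (nonpos_iff_eq_zero.1 (h ▸ hle 1 p))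
  have hm : ∀ N, Measurable fun p => c * (ENNReal.ofReal (f p ^ 2) / P p * truncS n s N p) :=
    fun N => (((hf.pow_const 2).ennreal_ofReal.div hPm).mul (measurable_truncS n s N)).const_mul _
  calc c * ∫⁻ p, ENNReal.ofReal (f p ^ 2) / P p * ENNReal.ofReal (phiS n s p)
      = ∫⁻ p, liminf (fun N => c * (ENNReal.ofReal (f p ^ 2) / P p * truncS n s N p)) atTop := by
        rw [← lintegral_const_mul' _ _ hcfin]
        refine lintegral_congr fun p => (Tendsto.liminf_eq ?_).symm
        exact ENNReal.Tendsto.const_mul (ENNReal.Tendsto.const_mul (tendsto_truncS s p)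
          (Or.inr (ENNReal.div_ne_top ENNReal.ofReal_ne_top (hP0 p)))) (Or.inr hcfin)
    _ ≤ liminf (fun N => ∫⁻ p, c * (ENNReal.ofReal (f p ^ 2) / P p * truncS n s N p)) atTop :=
        lintegral_liminf_le hm
    _ ≤ liminf (fun _ => I) atTop := by
        refine liminf_le_liminf ?_
        filter_upwards [eventually_ge_atTop 1] with N hN
        refine le_trans ?_ (gagliardo_ge_truncS hn hs hs1 hf hf2 hN)
        rw [lintegral_const_mul' _ _ hcfin]
        gcongr with p
        exact hle N p
    _ = I := liminf_const I

/-- The truncated squared homogeneous norm `min(1, |h|²)`. -/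
def truncSq {n : ℕ} (h : Heis n) : ℝ :=
  min 1 (√((‖h.1‖ ^ 2 + ‖h.2.1‖ ^ 2) ^ 2 + 16 * h.2.2 ^ 2))

lemma truncSq_nonneg {n : ℕ} (h : Heis n) : 0 ≤ truncSq h :=
  le_min zero_le_one (sqrt_nonneg _)

lemma measurable_truncSq {n : ℕ} : Measurable (truncSq (n := n)) := by
  unfold truncSq; fun_prop

lemma truncSq_hinv {n : ℕ} (h : Heis n) : truncSq (hinv h) = truncSq h := by
  simp [truncSq, hinv]

lemma truncSq_mul_rpow_le {b a t : ℝ} (hb : 1 / 2 < b) (ha : 0 ≤ a)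
    (hX : 0 < a ^ 2 + 16 * t ^ 2) :
    min 1 (√(a ^ 2 + 16 * t ^ 2)) * (a ^ 2 + 16 * t ^ 2) ^ (-b) ≤
      4 ^ b * ((1 + a) ^ 2 + 16 * t ^ 2) ^ (-b) + (1 - 2 ^ (-(b - 1 / 2)))⁻¹ *
        ((a ^ 2 + 16 * t ^ 2) ^ (-(b - 1 / 2)) - ((1 + a) ^ 2 + 16 * t ^ 2) ^ (-(b - 1 / 2))) := by
  set X := a ^ 2 + 16 * t ^ 2 with hXd
  set Y := (1 + a) ^ 2 + 16 * t ^ 2 with hYd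
  have hYX : 1 + X ≤ Y := by rw [hXd, hYd]; nlinarith
  have hY4 : Y ≤ 2 + 2 * X := by rw [hXd, hYd]; nlinarith [sq_nonneg (a - 1), sq_nonneg t]
  have hc : (2 : ℝ) ^ (-(b - 1 / 2)) < 1 := rpow_lt_one_of_one_lt_of_neg one_lt_two (by linarith)
  have h1 : 0 ≤ X ^ (-(b - 1 / 2)) - Y ^ (-(b - 1 / 2)) :=
    sub_nonneg.2 (rpow_le_rpow_of_nonpos hX (by linarith) (by linarith))
  have hi : 0 < (1 - (2 : ℝ) ^ (-(b - 1 / 2)))⁻¹ := inv_pos.2 (by linarith)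
  rcases le_total 1 X with h | h
  · have h2 : X ^ (-b) ≤ 4 ^ b * Y ^ (-b) := by
      have h3 : (4 * X) ^ (-b) ≤ Y ^ (-b) :=
        rpow_le_rpow_of_nonpos (by linarith) (by linarith) (by linarith)
      rw [mul_rpow (by norm_num) hX.le, rpow_neg (by norm_num : (0 : ℝ) ≤ 4)] at h3
      rwa [inv_mul_le_iff₀ (by positivity)] at h3
    calc min 1 (√X) * X ^ (-b) ≤ 1 * X ^ (-b) := by gcongr; exact min_le_left _ _
      _ ≤ _ := by rw [one_mul]; exact h2.trans (le_add_of_nonneg_right (by positivity))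
  · have h2 : Y ^ (-(b - 1 / 2)) ≤ 2 ^ (-(b - 1 / 2)) * X ^ (-(b - 1 / 2)) := by
      rw [← mul_rpow (by norm_num) hX.le]
      exact rpow_le_rpow_of_nonpos (by linarith) (by linarith) (by linarith)
    have hY : 0 < Y := by linarith
    calc min 1 (√X) * X ^ (-b) ≤ √X * X ^ (-b) := by gcongr; exact min_le_right _ _
      _ = X ^ (-(b - 1 / 2)) := by
        rw [sqrt_eq_rpow, ← rpow_add hX]; congr 1; ring
      _ ≤ (1 - 2 ^ (-(b - 1 / 2)))⁻¹ * (X ^ (-(b - 1 / 2)) - Y ^ (-(b - 1 / 2))) := by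
        rw [le_inv_mul_iff₀ (by linarith)]; linarith
      _ ≤ _ := le_add_of_nonneg_left (by positivity)

lemma lintegral_truncSq_mul_phiK_ne_top {n : ℕ} (hn : 1 ≤ n) {s : ℝ} (hs : 0 < s) (hs1 : s < 1) :
    ∫⁻ h : Heis n, ENNReal.ofReal (truncSq h * phiK n s 0 h) ≠ ∞ := by
  have hn' : (1 : ℝ) ≤ n := by exact_mod_cast hn
  set b : ℝ := ((n : ℝ) + 1 + s) / 2 with hb
  set c : ℝ := (1 - 2 ^ (-(b - 1 / 2)))⁻¹ with hcd
  have hle : ∀ᵐ h : Heis n, ENNReal.ofReal (truncSq h * phiK n s 0 h) ≤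
      ENNReal.ofReal (4 ^ b) * ENNReal.ofReal (phiK n s 1 h) +
        ENNReal.ofReal c * ENNReal.ofReal (etaK n (1 - s) 1 h) := by
    filter_upwards [ae_ne_zero hn] with h hh
    have hc : 0 ≤ c := by
      refine inv_nonneg.2 (sub_nonneg.2 ?_)
      exact rpow_le_one_of_one_le_of_nonpos one_le_two (by rw [hb]; linarith)
    have key := truncSq_mul_rpow_le (b := b) (a := ‖h.1‖ ^ 2 + ‖h.2.1‖ ^ 2) (t := h.2.2)
      (by rw [hb]; linarith) (by positivity) (quartic_pos hh)
    rw [← ENNReal.ofReal_mul (by positivity), ← ENNReal.ofReal_mul hc]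
    refine le_trans (ENNReal.ofReal_le_ofReal ?_) ENNReal.ofReal_add_le
    have e : -(((n : ℝ) + 1 + -(1 - s)) / 2) = -(b - 1 / 2) := by rw [hb]; ring
    unfold truncSq etaK phiK
    rw [e, ← hb]
    simpa only [zero_pow two_ne_zero, one_pow, zero_add] using key
  refine ne_top_of_le_ne_top ?_ (lintegral_mono_ae hle)
  rw [lintegral_add_left (((measurable_phiK n s 1).ennreal_ofReal).const_mul _),
    lintegral_const_mul' _ _ ENNReal.ofReal_ne_top, lintegral_const_mul' _ _ ENNReal.ofReal_ne_top,
    lintegral_phiK hn hs one_pos, lintegral_etaK hn (by linarith) (by linarith)]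
  finiteness

lemma abs_sum_mul_le {n : ℕ} (u v : EuclideanSpace ℝ (Fin n)) : |∑ j, u j * v j| ≤ ‖u‖ * ‖v‖ := by
  have h := abs_real_inner_le_norm v u
  rw [PiLp.inner_apply] at h
  simpa [mul_comm] using h

/-- Euclidean distance is locally controlled by the homogeneous norm. -/
lemma norm_sub_sq_le_truncSq {n : ℕ} {R : ℝ} {p q : Heis n} (hp : ‖p‖ ≤ R)
    (h : truncSq (hmul (hinv q) p) < 1) :
    ‖p - q‖ ^ 2 ≤ (2 + R) ^ 2 * truncSq (hmul (hinv q) p) := by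
  set k := hmul (hinv q) p with hk
  have hk1 : k.1 = p.1 - q.1 := by simp only [hk, hmul, hinv]; abel
  have hk2 : k.2.1 = p.2.1 - q.2.1 := by simp only [hk, hmul, hinv]; abel
  have hk3 : p.2.2 - q.2.2 = k.2.2 - 1 / 2 * (∑ j, k.2.1 j * p.1 j - ∑ j, k.1 j * p.2.1 j) := by
    rw [hk1, hk2, ← Finset.sum_sub_distrib]
    simp only [hk, hmul, hinv, PiLp.sub_apply, PiLp.neg_apply]
    have : ∀ j, -q.2.1 j * p.1 j - -q.1 j * p.2.1 j =
        (p.2.1 j - q.2.1 j) * p.1 j - (p.1 j - q.1 j) * p.2.1 j := fun j => by ring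
    simp only [this]
    ring
  set X := (‖k.1‖ ^ 2 + ‖k.2.1‖ ^ 2) ^ 2 + 16 * k.2.2 ^ 2 with hX
  have hN : truncSq k = √X := min_eq_right (by
    by_contra hc
    have : truncSq k = 1 := min_eq_left (not_le.1 hc).le
    linarith)
  set r := √√X with hr
  have hr0 : 0 ≤ r := sqrt_nonneg _
  have hr2 : r ^ 2 = √X := sq_sqrt (sqrt_nonneg _)
  have hr1 : r ≤ 1 := by
    have h1 : r ^ 2 < 1 := by rw [hr2, ← hN]; exact h
    nlinarith
  have hv : ‖k.1‖ ^ 2 + ‖k.2.1‖ ^ 2 ≤ r ^ 2 := by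
    rw [hr2]
    exact le_sqrt_of_sq_le (by rw [hX]; nlinarith [sq_nonneg k.2.2])
  have hx : ‖k.1‖ ≤ r := by
    exact (abs_le_of_sq_le_sq' (by nlinarith [sq_nonneg ‖k.2.1‖]) hr0).2
  have hy : ‖k.2.1‖ ≤ r := by
    exact (abs_le_of_sq_le_sq' (by nlinarith [sq_nonneg ‖k.1‖]) hr0).2
  have ht : |k.2.2| ≤ r := by
    have h1 : |4 * k.2.2| ≤ √X := abs_le_sqrt (by rw [hX]; nlinarith [sq_nonneg (‖k.1‖ ^ 2 + ‖k.2.1‖ ^ 2)])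
    rw [abs_mul, abs_of_pos (by norm_num : (0 : ℝ) < 4)] at h1
    nlinarith
  have hpx : ‖p.1‖ ≤ R := (norm_fst_le p).trans hp
  have hpy : ‖p.2.1‖ ≤ R := (norm_fst_le p.2).trans ((norm_snd_le p).trans hp)
  have hR : 0 ≤ R := (norm_nonneg _).trans hp
  have hs1 : |∑ j, k.2.1 j * p.1 j| ≤ r * R :=
    (abs_sum_mul_le _ _).trans (mul_le_mul hy hpx (norm_nonneg _) hr0)
  have hs2 : |∑ j, k.1 j * p.2.1 j| ≤ r * R :=
    (abs_sum_mul_le _ _).trans (mul_le_mul hx hpy (norm_nonneg _) hr0)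
  have hrR := mul_nonneg hr0 hR
  have h3 : ‖p - q‖ ≤ (2 + R) * r := by
    refine max_le ?_ (max_le ?_ ?_)
    · change ‖p.1 - q.1‖ ≤ _
      rw [← hk1]; linarith
    · change ‖p.2.1 - q.2.1‖ ≤ _
      rw [← hk2]; linarith
    · change |p.2.2 - q.2.2| ≤ _
      rw [hk3, abs_le]
      rw [abs_le] at ht hs1 hs2
      constructor <;> linarith
  rw [hN, ← hr2, ← mul_pow]
  exact pow_le_pow_left₀ (norm_nonneg _) h3 2

lemma sq_sub_le_truncSq {n : ℕ} {f : Heis n → ℝ} (hf : ContDiff ℝ 1 f)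
    (hfc : HasCompactSupport f) :
    ∃ C : ℝ, 0 ≤ C ∧ ∀ p q, (f p - f q) ^ 2 ≤ C * truncSq (hmul (hinv q) p) *
      ((tsupport f).indicator 1 p + (tsupport f).indicator 1 q) := by
  obtain ⟨L, hL⟩ := hf.lipschitzWith_of_hasCompactSupport hfc one_ne_zero
  obtain ⟨M, hM⟩ := hfc.exists_bound_of_continuous hf.continuous
  obtain ⟨R, hR⟩ := hfc.isCompact.exists_bound_of_continuousOn continuous_id.continuousOn
  have hLip : ∀ p q, (f p - f q) ^ 2 ≤ (L : ℝ) ^ 2 * ‖p - q‖ ^ 2 := fun p q => by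
    rw [← mul_pow, ← sq_abs (f p - f q)]
    exact pow_le_pow_left₀ (abs_nonneg _) (hL.norm_sub_le p q) 2
  have hbd : ∀ p q, (f p - f q) ^ 2 ≤ (2 * M) ^ 2 := fun p q => by
    rw [← sq_abs (f p - f q)]
    refine pow_le_pow_left₀ (abs_nonneg _) ?_ 2
    have h1 := hM p
    have h2 := hM q
    rw [norm_eq_abs, abs_le] at h1 h2
    rw [abs_le]
    constructor <;> linarith
  set C := (2 * M) ^ 2 + (L : ℝ) ^ 2 * (2 + R) ^ 2 with hC
  have hC0 : 0 ≤ C := by positivity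
  have main : ∀ p q, p ∈ tsupport f → (f p - f q) ^ 2 ≤ C * truncSq (hmul (hinv q) p) := by
    intro p q hp
    rcases lt_or_ge (truncSq (hmul (hinv q) p)) 1 with h | h
    · have h1 := norm_sub_sq_le_truncSq (hR p hp) h
      have h2 := truncSq_nonneg (hmul (hinv q) p)
      calc (f p - f q) ^ 2 ≤ (L : ℝ) ^ 2 * ((2 + R) ^ 2 * truncSq (hmul (hinv q) p)) :=
            (hLip p q).trans (mul_le_mul_of_nonneg_left h1 (sq_nonneg _))
        _ ≤ C * truncSq (hmul (hinv q) p) := by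
            rw [hC, add_mul, mul_assoc]
            exact le_add_of_nonneg_left (by positivity)
    · have h1 : truncSq (hmul (hinv q) p) = 1 := le_antisymm (min_le_left _ _) h
      rw [h1, mul_one]
      exact (hbd p q).trans (le_add_of_nonneg_right (by positivity))
  refine ⟨C, hC0, fun p q => ?_⟩
  have hind : ∀ r : Heis n, 0 ≤ (tsupport f).indicator (1 : Heis n → ℝ) r := fun r =>
    indicator_nonneg (fun _ _ => zero_le_one) r
  have hT := mul_nonneg hC0 (truncSq_nonneg (hmul (hinv q) p))
  by_cases hp : p ∈ tsupport f
  · refine (main p q hp).trans (le_mul_of_one_le_right hT ?_)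
    rw [indicator_of_mem hp]
    exact le_add_of_nonneg_right (hind q)
  by_cases hq : q ∈ tsupport f
  · have := main q p hq
    rw [← hinv_hmul_hinv, truncSq_hinv] at this
    rw [sub_sq_comm]
    refine this.trans (le_mul_of_one_le_right hT ?_)
    rw [indicator_of_mem hq]
    exact le_add_of_nonneg_left (hind p)
  · rw [image_eq_zero_of_notMem_tsupport hp, image_eq_zero_of_notMem_tsupport hq,
      sub_self, zero_pow two_ne_zero]
    exact mul_nonneg hT (add_nonneg (hind p) (hind q))

lemma lintegral_le_of_kernel_bound {X : Type*} [MeasurableSpace X] {μ : Measure X} [SFinite μ]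
    {F k : X → X → ℝ≥0∞} {χ : X → ℝ≥0∞} {C J : ℝ≥0∞} (hC : C ≠ ∞) (hχ : Measurable χ)
    (hk : Measurable fun z : X × X => k z.1 z.2)
    (hle : ∀ p q, F p q ≤ C * (χ p * k p q + χ q * k p q))
    (h1 : ∀ p, ∫⁻ q, k p q ∂μ = J) (h2 : ∀ q, ∫⁻ p, k p q ∂μ = J) :
    ∫⁻ p, ∫⁻ q, F p q ∂μ ∂μ ≤ C * ((∫⁻ p, χ p ∂μ) * J + (∫⁻ p, χ p ∂μ) * J) := by
  have hm1 : Measurable fun z : X × X => χ z.1 * k z.1 z.2 := (hχ.comp measurable_fst).mul hk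
  have hm2 : Measurable fun z : X × X => χ z.2 * k z.1 z.2 := (hχ.comp measurable_snd).mul hk
  have e1 : ∫⁻ p, ∫⁻ q, χ p * k p q ∂μ ∂μ = (∫⁻ p, χ p ∂μ) * J := by
    rw [← lintegral_mul_const _ hχ]
    refine lintegral_congr fun p => ?_
    have : Measurable fun q => k p q := hk.comp (measurable_const.prodMk measurable_id)
    rw [lintegral_const_mul _ this, h1]
  have e2 : ∫⁻ p, ∫⁻ q, χ q * k p q ∂μ ∂μ = (∫⁻ p, χ p ∂μ) * J := by
    rw [lintegral_lintegral_swap hm2.aemeasurable, ← lintegral_mul_const _ hχ]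
    refine lintegral_congr fun q => ?_
    have : Measurable fun p => k p q := hk.comp (measurable_id.prodMk measurable_const)
    rw [lintegral_const_mul _ this, h2]
  refine (lintegral_mono fun p => lintegral_mono fun q => hle p q).trans (le_of_eq ?_)
  rw [← e2]
  nth_rw 1 [e2, ← e1]
  rw [← lintegral_add_left (Measurable.lintegral_prod_right' hm1), ← lintegral_const_mul' _ _ hC]
  refine lintegral_congr fun p => ?_
  have : Measurable fun q => χ p * k p q := hm1.comp (measurable_const.prodMk measurable_id)
  rw [lintegral_const_mul' _ _ hC, lintegral_add_left this]

lemma lintegral_gagliardo_ne_top {n : ℕ} (hn : 1 ≤ n) {s : ℝ} (hs : 0 < s) (hs1 : s < 1)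
    {f : Heis n → ℝ} (hf : ContDiff ℝ 1 f) (hfc : HasCompactSupport f) :
    ∫⁻ p, ∫⁻ q, ENNReal.ofReal ((f p - f q) ^ 2) *
      ENNReal.ofReal (phiK n s 0 (hmul (hinv q) p)) ≠ ∞ := by
  obtain ⟨C, hC, hle⟩ := sq_sub_le_truncSq hf hfc
  set k : Heis n → ℝ≥0∞ := fun h => ENNReal.ofReal (truncSq h * phiK n s 0 h) with hk
  have hkm : Measurable k := (measurable_truncSq.mul (measurable_phiK n s 0)).ennreal_ofReal
  set χ : Heis n → ℝ≥0∞ := (tsupport f).indicator 1 with hχ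
  have hχm : Measurable χ := measurable_one.indicator (isClosed_tsupport f).measurableSet
  have hχ1 : ∀ p, ENNReal.ofReal ((tsupport f).indicator (1 : Heis n → ℝ) p) = χ p := fun p => by
    by_cases h : p ∈ tsupport f <;> simp [hχ, h]
  have hind : ∀ r : Heis n, 0 ≤ (tsupport f).indicator (1 : Heis n → ℝ) r := fun r =>
    indicator_nonneg (fun _ _ => zero_le_one) r
  have hK : ∫⁻ p, χ p ≠ ∞ := by
    rw [hχ, lintegral_indicator_one (isClosed_tsupport f).measurableSet]
    exact hfc.isCompact.measure_lt_top.ne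
  have hpt : ∀ p q, ENNReal.ofReal ((f p - f q) ^ 2) *
      ENNReal.ofReal (phiK n s 0 (hmul (hinv q) p)) ≤
      ENNReal.ofReal C * (χ p * k (hmul (hinv q) p) + χ q * k (hmul (hinv q) p)) := by
    intro p q
    have h0 := phiK_nonneg n s 0 (hmul (hinv q) p)
    rw [← ENNReal.ofReal_mul (sq_nonneg _), ← add_mul, ← hχ1, ← hχ1,
      ← ENNReal.ofReal_add (hind p) (hind q), hk,
      ← ENNReal.ofReal_mul (add_nonneg (hind p) (hind q)), ← ENNReal.ofReal_mul hC]
    refine ENNReal.ofReal_le_ofReal ((mul_le_mul_of_nonneg_right (hle p q) h0).trans (le_of_eq ?_))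
    ring
  have hmk : Measurable fun z : Heis n × Heis n => k (hmul (hinv z.2) z.1) :=
    hkm.comp (continuous_hmul.comp ((continuous_hinv.comp continuous_snd).prodMk
      continuous_fst)).measurable
  have hkfin := lintegral_truncSq_mul_phiK_ne_top hn hs hs1
  refine ne_top_of_le_ne_top ?_ (lintegral_le_of_kernel_bound (μ := volume)
    (k := fun p q => k (hmul (hinv q) p)) ENNReal.ofReal_ne_top hχm hmk hpt
    (fun p => lintegral_hinv_hmul hkm p) (fun q => lintegral_hmul_left hkm (hinv q)))
  exact ENNReal.mul_ne_top ENNReal.ofReal_ne_top (ENNReal.add_ne_top.2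
    ⟨ENNReal.mul_ne_top hK hkfin, ENNReal.mul_ne_top hK hkfin⟩)

/-- `A_{n,s} = (4^{1+s} s / π^{n+1/2})·Γ(n+s)Γ((n+1+s)/2)/(Γ((n+s)/2)Γ(1−s))`. -/
def gagliardoConst (n : ℕ) (s : ℝ) : ℝ :=
  (4 : ℝ) ^ (1 + s) * s / π ^ ((n : ℝ) + 1 / 2) *
    (Gamma ((n : ℝ) + s) * Gamma (((n : ℝ) + 1 + s) / 2)) /
    (Gamma (((n : ℝ) + s) / 2) * Gamma (1 - s))

lemma gagliardoConst_pos (n : ℕ) {s : ℝ} (hs : 0 < s) (hs1 : s < 1) :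
    0 < gagliardoConst n s := by
  have h1 : 0 < Gamma ((n : ℝ) + s) := Gamma_pos_of_pos (by positivity)
  have h2 : 0 < Gamma (((n : ℝ) + 1 + s) / 2) := Gamma_pos_of_pos (by positivity)
  have h3 : 0 < Gamma (((n : ℝ) + s) / 2) := Gamma_pos_of_pos (by positivity)
  have h4 : 0 < Gamma (1 - s) := Gamma_pos_of_pos (by linarith)
  unfold gagliardoConst
  positivity

lemma C1_pos (n : ℕ) {s : ℝ} (hs : 0 < s) : 0 < C1 n s := by
  have h1 : 0 < Gamma ((n : ℝ) + s) := Gamma_pos_of_pos (by positivity)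
  have h2 : 0 < Gamma (((n : ℝ) + 1 + s) / 2) := Gamma_pos_of_pos (by positivity)
  have h3 : 0 < Gamma (((n : ℝ) + s) / 2) := Gamma_pos_of_pos (by positivity)
  have h4 : 0 < Gamma s := Gamma_pos_of_pos hs
  unfold C1
  positivity

lemma etaMass_pos (n : ℕ) {s : ℝ} (hs : 0 < s) (hs1 : s < 1) : 0 < etaMass n s := by
  have h1 : 0 < Gamma (((n : ℝ) + 1 + -s) / 2) :=
    Gamma_pos_of_pos (by linarith [n.cast_nonneg (α := ℝ)])
  have h2 : 0 < Gamma (1 - s) := Gamma_pos_of_pos (by linarith)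
  unfold etaMass
  positivity

lemma gagliardoConst_mul_eq {n : ℕ} {s : ℝ} (hs : 0 < s) (hs1 : s < 1) :
    gagliardoConst n s * (massK n s 1 * etaMass n s) =
      (4 : ℝ) ^ (2 * s) *
        (Gamma (((n : ℝ) + 1 + s) / 2) / Gamma (((n : ℝ) + 1 - s) / 2)) ^ 2 * (C1 n s)⁻¹ := by
  rw [eq_mul_inv_iff_mul_eq₀ (C1_pos n hs).ne']
  have hn := n.cast_nonneg (α := ℝ)
  have hdup := Gamma_mul_Gamma_add_half (((n : ℝ) + s) / 2)
  rw [show ((n : ℝ) + s) / 2 + 1 / 2 = ((n : ℝ) + 1 + s) / 2 by ring,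
    show 2 * (((n : ℝ) + s) / 2) = n + s by ring,
    show 1 - ((n : ℝ) + s) = 1 + -s - n by ring, rpow_sub_natCast two_ne_zero,
    rpow_add two_pos, rpow_one, rpow_neg two_pos.le] at hdup
  have h4 : (4 : ℝ) ^ s = (2 ^ s) ^ 2 := by
    rw [show (4 : ℝ) = 2 ^ (2 : ℕ) by norm_num, ← rpow_natCast_mul two_pos.le,
      ← rpow_mul_natCast two_pos.le, mul_comm]
  have hpi : π ^ ((n : ℝ) + 1 / 2) = π ^ n * √π := by
    rw [rpow_add pi_pos, rpow_natCast, sqrt_eq_rpow]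
  unfold gagliardoConst massK etaMass C1
  rw [one_pow, mul_one, rpow_neg two_pos.le, hpi, rpow_add (by norm_num), rpow_one,
    mul_comm 2 s, rpow_mul (by norm_num), rpow_two, h4,
    show ((n : ℝ) + 1 + -s) / 2 = ((n : ℝ) + 1 - s) / 2 by ring, div_pow π 2 n]
  have g1 : 0 < Gamma ((n : ℝ) + s) := Gamma_pos_of_pos (by positivity)
  have g2 : 0 < Gamma (((n : ℝ) + 1 + s) / 2) := Gamma_pos_of_pos (by positivity)
  have g3 : 0 < Gamma (((n : ℝ) + s) / 2) := Gamma_pos_of_pos (by positivity)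
  have g4 : 0 < Gamma (1 - s) := Gamma_pos_of_pos (by linarith)
  have g5 : 0 < Gamma s := Gamma_pos_of_pos hs
  have g6 : 0 < Gamma (((n : ℝ) + 1 - s) / 2) := Gamma_pos_of_pos (by linarith)
  generalize Gamma ((n : ℝ) + s) = G1 at *
  generalize Gamma (((n : ℝ) + 1 + s) / 2) = G2 at *
  generalize Gamma (((n : ℝ) + s) / 2) = G3 at *
  generalize Gamma (1 - s) = G4 at *
  generalize Gamma s = G5 at *
  generalize Gamma (((n : ℝ) + 1 - s) / 2) = G6 at *
  have hz : 0 < (2 : ℝ) ^ s := by positivity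
  generalize (2 : ℝ) ^ s = z at *
  have hp : 0 < (π : ℝ) ^ n := by positivity
  have hp2 : 0 < (2 : ℝ) ^ n := by positivity
  generalize (2 : ℝ) ^ n = u at *
  generalize (π : ℝ) ^ n = w at *
  have hpi0 := pi_pos
  have hsq : π = √π ^ 2 := (sq_sqrt pi_pos.le).symm
  have hr : 0 < √π := by positivity
  generalize √π = r at *
  have hG1 : G1 = G3 * G2 * u * z / (2 * r) := by
    field_simp at hdup ⊢
    linarith
  rw [hG1, hsq]
  field_simp
  norm_num

lemma hnorm_rpow {n : ℕ} (a : ℝ) (p : Heis n) :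
    hnorm p ^ (-(2 * ((n : ℝ) + 1 + a))) = phiK n a 0 p := by
  unfold hnorm phiK
  rw [← rpow_mul (by positivity), zero_pow two_ne_zero, zero_add]
  congr 1
  ring

lemma potE_phiS_ne_zero {n : ℕ} (hn : 1 ≤ n) (s : ℝ) (p : Heis n) :
    potE s (fun r => ENNReal.ofReal (phiS n s r)) p ≠ 0 := fun h =>
  potE_truncS_ne_zero hn s le_rfl p (nonpos_iff_eq_zero.1
    (h ▸ lintegral_mono fun r => mul_le_mul_left (truncS_le_phiS n s 1 r) _))

lemma psiS_eq (n : ℕ) (s : ℝ) (p : Heis n) :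
    psiS n s p = C1 n s * (potE s (fun r => ENNReal.ofReal (phiS n s r)) p).toReal := by
  unfold psiS potE
  have e : -(2 * (n : ℝ) + 2 - 2 * s) = -(2 * ((n : ℝ) + 1 + -s)) := by ring
  simp only [e, hnorm_rpow]
  rw [lintegral_hmul_hinv_swap (measurable_phiS n s).ennreal_ofReal
    (measurable_phiK n (-s) 0).ennreal_ofReal, integral_eq_lintegral_of_nonneg_ae]
  · simp only [ENNReal.ofReal_mul (phiS_nonneg n s _)]
  · exact Eventually.of_forall fun q => mul_nonneg (phiS_nonneg n s _) (phiK_nonneg n _ _ _)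
  · exact (((measurable_phiS n s).comp ((measurable_hmul_left p).comp
      continuous_hinv.measurable)).mul (measurable_phiK n (-s) 0)).aestronglyMeasurable

lemma psiS_nonneg (n : ℕ) {s : ℝ} (hs : 0 < s) (p : Heis n) : 0 ≤ psiS n s p := by
  rw [psiS_eq]
  exact mul_nonneg (C1_pos n hs).le ENNReal.toReal_nonneg

lemma measurable_psiS (n : ℕ) (s : ℝ) : Measurable (psiS n s) := by
  have : psiS n s = fun p => C1 n s *
      (potE s (fun r => ENNReal.ofReal (phiS n s r)) p).toReal := funext (psiS_eq n s)
  rw [this]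
  exact (measurable_potE s (measurable_phiS n s).ennreal_ofReal).ennreal_toReal.const_mul _

lemma integral_weight_eq {n : ℕ} (hn : 1 ≤ n) {s : ℝ} (hs : 0 < s) {f : Heis n → ℝ}
    (hf : Measurable f) :
    ∫ p : Heis n, f p ^ 2 * (phiS n s p / psiS n s p) = (C1 n s)⁻¹ *
      (∫⁻ p, ENNReal.ofReal (f p ^ 2) / potE s (fun r => ENNReal.ofReal (phiS n s r)) p *
          ENNReal.ofReal (phiS n s p)).toReal := by
  have hC := C1_pos n hs
  rw [integral_eq_lintegral_of_nonneg_ae]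
  · rw [← ENNReal.toReal_ofReal (inv_pos.2 hC).le, ← ENNReal.toReal_mul,
      ← lintegral_const_mul' _ _ ENNReal.ofReal_ne_top]
    congr 1
    refine lintegral_congr fun p => ?_
    rw [psiS_eq]
    have h0 := potE_phiS_ne_zero hn s p
    generalize potE s (fun r : Heis n => ENNReal.ofReal (phiS n s r)) p = P at *
    rcases eq_or_ne P ∞ with rfl | hP
    · simp
    · have hP' : 0 < P.toReal := ENNReal.toReal_pos h0 hP
      nth_rw 2 [← ENNReal.ofReal_toReal hP]
      rw [← ENNReal.ofReal_div_of_pos hP', ← ENNReal.ofReal_mul (by positivity),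
        ← ENNReal.ofReal_mul (inv_pos.2 hC).le]
      congr 1
      field_simp
  · exact Eventually.of_forall fun p => mul_nonneg (sq_nonneg _)
      (div_nonneg (phiS_nonneg n s p) (psiS_nonneg n hs p))
  · exact ((hf.pow_const 2).mul ((measurable_phiS n s).div
      (measurable_psiS n s))).aestronglyMeasurable

lemma integral_integral_eq_toReal {X : Type*} [MeasurableSpace X] {μ : Measure X} [SFinite μ]
    {F : X → X → ℝ} (hF : Measurable fun z : X × X => F z.1 z.2) (h0 : ∀ p q, 0 ≤ F p q)
    (hfin : ∫⁻ p, ∫⁻ q, ENNReal.ofReal (F p q) ∂μ ∂μ ≠ ∞) :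
    ∫ p, ∫ q, F p q ∂μ ∂μ = (∫⁻ p, ∫⁻ q, ENNReal.ofReal (F p q) ∂μ ∂μ).toReal := by
  have e : ∫⁻ z, ENNReal.ofReal (F z.1 z.2) ∂μ.prod μ =
      ∫⁻ p, ∫⁻ q, ENNReal.ofReal (F p q) ∂μ ∂μ :=
    lintegral_prod _ hF.ennreal_ofReal.aemeasurable
  have hnn : 0 ≤ᵐ[μ.prod μ] fun z => F z.1 z.2 := Eventually.of_forall fun z => h0 z.1 z.2
  have h_int : Integrable (fun z : X × X => F z.1 z.2) (μ.prod μ) := by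
    refine ⟨hF.aestronglyMeasurable, ?_⟩
    rw [hasFiniteIntegral_iff_ofReal hnn, e]
    exact hfin.lt_top
  rw [integral_integral h_int, integral_eq_lintegral_of_nonneg_ae hnn hF.aestronglyMeasurable, e]

lemma gagliardo_integral_eq {n : ℕ} (hn : 1 ≤ n) {s : ℝ} (hs : 0 < s) (hs1 : s < 1)
    {f : Heis n → ℝ} (hf : ContDiff ℝ 1 f) (hfc : HasCompactSupport f) :
    ∫ p : Heis n, ∫ q : Heis n,
        (f p - f q) ^ 2 * hnorm (hmul (hinv q) p) ^ (-(2 * (n : ℝ) + 2 + 2 * s)) =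
      (∫⁻ p, ∫⁻ q, ENNReal.ofReal ((f p - f q) ^ 2) *
        ENNReal.ofReal (phiK n s 0 (hmul (hinv q) p))).toReal := by
  have e : -(2 * (n : ℝ) + 2 + 2 * s) = -(2 * ((n : ℝ) + 1 + s)) := by ring
  have hfin := lintegral_gagliardo_ne_top hn hs hs1 hf hfc
  have hfm : Measurable f := hf.continuous.measurable
  have hm : Measurable fun z : Heis n × Heis n =>
      (f z.1 - f z.2) ^ 2 * phiK n s 0 (hmul (hinv z.2) z.1) :=
    (((hfm.comp measurable_fst).sub (hfm.comp measurable_snd)).pow_const 2).mul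
      ((measurable_phiK n s 0).comp (continuous_hmul.comp ((continuous_hinv.comp
        continuous_snd).prodMk continuous_fst)).measurable)
  simp only [← ENNReal.ofReal_mul (sq_nonneg _)] at hfin ⊢
  simp only [e, hnorm_rpow]
  exact integral_integral_eq_toReal hm
    (fun p q => mul_nonneg (sq_nonneg _) (phiK_nonneg n s 0 _)) hfin

lemma lintegral_sq_ne_top {X : Type*} [TopologicalSpace X] [MeasurableSpace X]
    [OpensMeasurableSpace X] {μ : Measure X} [IsFiniteMeasureOnCompacts μ] {f : X → ℝ}
    (hf : Continuous f) (hfc : HasCompactSupport f) : ∫⁻ p, ENNReal.ofReal (f p ^ 2) ∂μ ≠ ∞ := by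
  have hc : Continuous fun p => f p ^ 2 := hf.pow 2
  have hs : HasCompactSupport fun p => f p ^ 2 :=
    HasCompactSupport.comp_left (g := fun x : ℝ => x ^ 2) hfc (by simp)
  have hi : Integrable (fun p => f p ^ 2) μ := hc.integrable_of_hasCompactSupport hs
  rw [← ofReal_integral_eq_lintegral_ofReal hi (Eventually.of_forall fun p => sq_nonneg (f p))]
  exact ENNReal.ofReal_ne_top

lemma hardy_of_contDiff {n : ℕ} (hn : 1 ≤ n) {s : ℝ} (hs : 0 < s) (hs1 : s < 1)
    {f : Heis n → ℝ} (hf : ContDiff ℝ 1 f) (hfc : HasCompactSupport f) :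
    (4 : ℝ) ^ (2 * s) *
        (Gamma (((n : ℝ) + 1 + s) / 2) / Gamma (((n : ℝ) + 1 - s) / 2)) ^ 2 *
      ∫ p : Heis n, f p ^ 2 * (phiS n s p / psiS n s p) ≤
    gagliardoConst n s / 2 * ∫ p : Heis n, ∫ q : Heis n,
        (f p - f q) ^ 2 * hnorm (hmul (hinv q) p) ^ (-(2 * (n : ℝ) + 2 + 2 * s)) := by
  have hfm : Measurable f := hf.continuous.measurable
  have hf2 := lintegral_sq_ne_top (μ := volume) hf.continuous hfc
  have h := ENNReal.toReal_mono (lintegral_gagliardo_ne_top hn hs hs1 hf hfc)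
    (gagliardo_ge_phiS hn hs hs1 hfm hf2)
  rw [← gagliardo_integral_eq hn hs hs1 hf hfc, ENNReal.toReal_mul, ENNReal.toReal_mul,
    ENNReal.toReal_mul, ENNReal.toReal_ofReal (massK_pos hs one_pos).le,
    ENNReal.toReal_ofReal (etaMass_pos n hs hs1).le, ENNReal.toReal_ofNat] at h
  rw [integral_weight_eq hn hs hfm, ← mul_assoc, ← gagliardoConst_mul_eq hs hs1]
  have h2 := mul_le_mul_of_nonneg_left h (half_pos (gagliardoConst_pos n hs hs1)).le
  refine le_trans (le_of_eq ?_) h2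
  ring

end Heis

theorem stmt_17 (n : ℕ) (hn : 1 ≤ n) (s : ℝ) (hs0 : 0 < s) (hs1 : s < 1 / 2)
    (f : Heis n → ℝ) (hf : ContDiff ℝ (⊤ : ℕ∞) f) (hfc : HasCompactSupport f) :
    (4 : ℝ) ^ (1 + s) * s / π ^ ((n : ℝ) + 1 / 2) *
        (Gamma ((n : ℝ) + s) * Gamma (((n : ℝ) + 1 + s) / 2)) /
        (Gamma (((n : ℝ) + s) / 2) * Gamma (1 - s)) / 2 *
      (∫ p : Heis n, ∫ q : Heis n,
        (f p - f q) ^ 2 * hnorm (hmul (hinv q) p) ^ (-(2 * (n : ℝ) + 2 + 2 * s))) ≥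
    (4 : ℝ) ^ (2 * s) *
        (Gamma (((n : ℝ) + 1 + s) / 2) / Gamma (((n : ℝ) + 1 - s) / 2)) ^ 2 *
      ∫ p : Heis n, f p ^ 2 * (phiS n s p / psiS n s p) := by
  exact hardy_of_contDiff hn hs0 (by linarith) (hf.of_le (by exact_mod_cast le_top)) hfc
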